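/- arXiv:2202.08140 — 2 statements merged into one kernel-verified Lean document; each statement's English description precedes it below -/
import Mathlib

section
/- Every weakly Rickart C*-algebra A coincides with the closed linear span of its projections; in particular, every positive element a ∈ A is a norm-limit of finite linear combinations of projections of A. -/
/-- A projection in a C*-algebra: a self-adjoint idempotent. -/
def IsProjection {A : Type*} [Mul A] [Star A] (p : A) : Prop :=
  star p = p ∧ p * p = p

/-- `p` is an annihilating right projection (ARP) of `x`. -/
def IsARP {A : Type*} [Mul A] [Star A] [Zero A] (x p : A) : Prop :=
  IsProjection p ∧ x * p = x ∧ ∀ y : A, x * y = 0 → p * y = 0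

/-- A C*-algebra is weakly Rickart if every element admits an ARP. -/
def WeaklyRickart (A : Type*) [NonUnitalCStarAlgebra A] : Prop :=
  ∀ x : A, ∃ p : A, IsARP x p

/-- If `x` has ARP `p` and `m` is self-adjoint with `x * m = c • x`, then
`p * m = m * p = c • p`. -/
lemma IsARP.mul_eq_smul {A : Type*} [NonUnitalCStarAlgebra A] {x m p : A} {c : ℝ}
    (hp : IsARP x p) (hm : IsSelfAdjoint m) (hxm : x * m = c • x) :
    p * m = c • p ∧ m * p = c • p := by
  obtain ⟨⟨hps, hpp⟩, hxp, hker⟩ := hp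
  have h1 : p * (c • p - m * p) = 0 := hker _ (by
    rw [mul_sub, ← mul_assoc, hxm, mul_smul_comm, smul_mul_assoc, hxp, sub_self])
  have h2 : p * (m - m * p) = 0 := hker _ (by
    rw [mul_sub, ← mul_assoc, hxm, smul_mul_assoc, hxp, sub_self])
  have h3 : p * m = c • p := by
    rw [mul_sub, sub_eq_zero] at h1 h2
    rw [h2, ← h1, mul_smul_comm, hpp]
  refine ⟨h3, ?_⟩
  simpa [hps, hm.star_eq] using congrArg star h3

section Order

variable {A : Type*} [NonUnitalCStarAlgebra A] [PartialOrder A] [StarOrderedRing A]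

/-- Subtracting a multiple of a projection halves the norm of a positive element. -/
lemma WeaklyRickart.exists_projection_sub (hA : WeaklyRickart A) {a : A} (ha : 0 ≤ a) {c : ℝ}
    (hac : ‖a‖ ≤ 2 * c) :
    ∃ p : A, IsProjection p ∧ 0 ≤ a - c • p ∧ ‖a - c • p‖ ≤ c := by
  have hc : 0 ≤ c := by linarith [norm_nonneg a]
  have hsa : IsSelfAdjoint a := ha.isSelfAdjoint
  have hf0 : max ((0 : ℝ) - c) 0 = 0 := by simpa using hc
  have hg0 : min (0 : ℝ) c = 0 := by simpa using hc
  have hσ : ∀ t ∈ quasispectrum ℝ a, 0 ≤ t ∧ t ≤ 2 * c := fun t ht ↦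
    ⟨quasispectrum_nonneg_of_nonneg a ha t ht, (le_abs_self t).trans <|
      (NonUnitalIsometricContinuousFunctionalCalculus.norm_quasispectrum_le a ht).trans hac⟩
  set x : A := cfcₙ (fun t : ℝ ↦ max (t - c) 0) a with hx
  set m : A := cfcₙ (fun t : ℝ ↦ min t c) a with hm
  have hx0 : 0 ≤ x := cfcₙ_nonneg fun t _ ↦ le_max_right _ _
  have hm0 : 0 ≤ m := cfcₙ_nonneg fun t ht ↦ le_min (hσ t ht).1 hc
  have hxn : ‖x‖ ≤ c := norm_cfcₙ_le fun t ht ↦ by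
    rw [Real.norm_of_nonneg (le_max_right _ _)]
    exact max_le (by linarith [(hσ t ht).2]) hc
  have hmn : ‖m‖ ≤ c := norm_cfcₙ_le fun t ht ↦ by
    rw [Real.norm_of_nonneg (le_min (hσ t ht).1 hc)]
    exact min_le_right _ _
  have hxma : x + m = a := by
    rw [hx, hm, ← cfcₙ_add (fun t ↦ max (t - c) 0) (fun t ↦ min t c) a (by fun_prop) hf0
      (by fun_prop) hg0]
    conv_rhs => rw [← cfcₙ_id' ℝ a]
    congr 1
    ext t
    grind
  have hxm : x * m = c • x := by
    rw [hx, hm, ← cfcₙ_mul (fun t ↦ max (t - c) 0) (fun t ↦ min t c) a (by fun_prop) hf0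
      (by fun_prop) hg0,
      ← cfcₙ_smul c (fun t ↦ max (t - c) 0) a (by fun_prop) hf0]
    congr 1
    ext t
    rcases le_total t c with h | h <;> simp [h, mul_comm]
  have hmx : m * x = c • x := by
    simpa [hx0.isSelfAdjoint.star_eq, hm0.isSelfAdjoint.star_eq] using congrArg star hxm
  obtain ⟨p, hp⟩ := hA x
  obtain ⟨hpm, hmp⟩ := hp.mul_eq_smul hm0.isSelfAdjoint hxm
  obtain ⟨⟨hps, hpp⟩, hxp, -⟩ := hp
  have hpx : p * x = x := by
    simpa [hx0.isSelfAdjoint.star_eq, hps] using congrArg star hxp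
  have hp0 : 0 ≤ p := by simpa [hps, hpp] using star_mul_self_nonneg p
  have hz0 : 0 ≤ m - c • p := by
    obtain ⟨b, hb⟩ := CStarAlgebra.nonneg_iff_eq_star_mul_self.mp hm0
    have : m - c • p = star (b - b * p) * (b - b * p) := by
      have h : star (b - b * p) * (b - b * p) =
          star b * b - star b * b * p - p * (star b * b) + p * (star b * b * p) := by
        simp only [star_sub, star_mul, hps]
        noncomm_ring
      rw [h, ← hb, hmp, hpm, mul_smul_comm, hpp]
      abel
    exact this ▸ star_mul_self_nonneg _
  have hzn : ‖m - c • p‖ ≤ c :=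
    (CStarAlgebra.norm_le_norm_of_nonneg_of_le hz0 (sub_le_self _ (smul_nonneg hc hp0))).trans hmn
  have hxz : x * (m - c • p) = 0 := by rw [mul_sub, hxm, mul_smul_comm, hxp, sub_self]
  have hzx : (m - c • p) * x = 0 := by rw [sub_mul, hmx, smul_mul_assoc, hpx, sub_self]
  have hsum : a - c • p = x + (m - c • p) := by rw [← hxma, add_sub_assoc]
  refine ⟨p, ⟨hps, hpp⟩, hsum ▸ add_nonneg hx0 hz0, ?_⟩
  rw [hsum, IsStarNormal.norm_add_eq_max hx0.isSelfAdjoint.isStarNormal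
    hz0.isSelfAdjoint.isStarNormal (hxz.trans hzx.symm) hxz]
  exact max_le hxn hzn

/-- Binary expansion of a positive element along projections. -/
lemma WeaklyRickart.exists_mem_span_sub (hA : WeaklyRickart A) {a : A} (ha : 0 ≤ a) (n : ℕ) :
    ∃ s ∈ Submodule.span ℂ {p : A | IsProjection p}, 0 ≤ a - s ∧ ‖a - s‖ ≤ ‖a‖ * (1 / 2) ^ n := by
  induction n with
  | zero => exact ⟨0, zero_mem _, by simpa using ha, by simp⟩
  | succ n ih =>
    obtain ⟨s, hs, hs0, hsn⟩ := ih
    obtain ⟨p, hp, hp0, hpn⟩ := hA.exists_projection_sub hs0 (c := ‖a‖ * (1 / 2) ^ (n + 1))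
      (hsn.trans_eq (by ring))
    refine ⟨s + (‖a‖ * (1 / 2) ^ (n + 1) : ℝ) • p, add_mem hs ?_, ?_, ?_⟩
    · rw [← Complex.coe_smul]
      exact Submodule.smul_mem _ _ (Submodule.subset_span hp)
    · rwa [← sub_sub]
    · rwa [← sub_sub]

lemma WeaklyRickart.mem_topologicalClosure_of_nonneg (hA : WeaklyRickart A) {a : A} (ha : 0 ≤ a) :
    a ∈ (Submodule.span ℂ {p : A | IsProjection p}).topologicalClosure := by
  choose s hs _ hsn using hA.exists_mem_span_sub ha
  refine mem_closure_of_tendsto (f := s) (b := Filter.atTop) ?_ (.of_forall hs)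
  rw [tendsto_iff_norm_sub_tendsto_zero]
  refine squeeze_zero (fun _ ↦ norm_nonneg _) (fun n ↦ (norm_sub_rev _ _).trans_le (hsn n)) ?_
  simpa using (tendsto_pow_atTop_nhds_zero_of_lt_one (r := (1 / 2 : ℝ))
    (by norm_num) (by norm_num)).const_mul ‖a‖

end Order

/-- Every weakly Rickart C*-algebra coincides with the closed linear span of its
projections; in particular every element (so, in particular, every positive element)
is a norm-limit of finite linear combinations of projections. -/
theorem weaklyRickart_generated_by_projections {A : Type*} [NonUnitalCStarAlgebra A]
    (hA : WeaklyRickart A) :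
    closure ((Submodule.span ℂ {p : A | IsProjection p} : Submodule ℂ A) : Set A)
      = Set.univ := by
  let _ := CStarAlgebra.spectralOrder A
  have _ := CStarAlgebra.spectralOrderedRing A
  have h : (Submodule.span ℂ {p : A | IsProjection p}).topologicalClosure = ⊤ := by
    rw [eq_top_iff, ← CStarAlgebra.span_nonneg, Submodule.span_le]
    exact fun a ha ↦ hA.mem_topologicalClosure_of_nonneg ha
  rw [← Submodule.topologicalClosure_coe, h, Submodule.top_coe]
end

section
/- A C*-algebra A is a weakly Rickart C*-algebra if and only if: for every x ∈ A and every inner ideal J ⊆ A which is orthogonal to the inner ideal A(x) generated by x, there exists a partial isometry e ∈ A such that A(x) ⊆ A₂(e) and J ⊆ A₀(e). -/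
/-- A partial isometry: an element `e` such that `e * e*` is a projection. -/
def IsPartialIsometry {A : Type*} [Mul A] [Star A] (e : A) : Prop :=
  IsProjection (e * star e)

/-- The Peirce-2 subspace associated with a partial isometry `e`. -/
def Peirce2 {A : Type*} [Mul A] [Star A] (e : A) : Set A :=
  {z : A | e * star e * z * (star e * e) = z}

/-- The Peirce-0 subspace associated with a partial isometry `e`. -/
def Peirce0 {A : Type*} [Mul A] [Star A] [Zero A] (e : A) : Set A :=
  {z : A | e * star e * z = 0 ∧ z * (star e * e) = 0}

/-- Orthogonality of elements in a C*-algebra: `a ⊥ b` iff `a b* = 0` and `b* a = 0`. -/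
def Orthog {A : Type*} [Mul A] [Star A] [Zero A] (a b : A) : Prop :=
  a * star b = 0 ∧ star b * a = 0

/-- A linear subspace `J` is an inner ideal if `x a y ∈ J` for all `x, y ∈ J`, `a ∈ A`. -/
def IsInnerIdeal {A : Type*} [NonUnitalCStarAlgebra A] (J : Submodule ℂ A) : Prop :=
  ∀ x ∈ J, ∀ y ∈ J, ∀ a : A, x * a * y ∈ J

/-- The inner ideal of `A` generated by `x`: the norm closure of `x A x`. -/
def innerIdealGen {A : Type*} [NonUnitalCStarAlgebra A] (x : A) : Set A :=
  closure {z : A | ∃ a : A, z = x * a * x}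

section Basics

variable {A : Type*} [NonUnitalCStarAlgebra A]

lemma eq_zero_of_forall_mul {c : A} (h : ∀ z, c * z = 0) : c = 0 :=
  (CStarRing.mul_star_self_eq_zero_iff c).1 (h _)

lemma sub_mul_eq_zero_of_forall {a b : A} (h : ∀ z, a * z = b * z) : a = b :=
  sub_eq_zero.1 <| eq_zero_of_forall_mul fun z => by rw [sub_mul, h, sub_self]

lemma mul_eq_zero_of_star_mul_self {x y z : A} (h : star x * x = star y * y) (hx : x * z = 0) :
    y * z = 0 := by
  rw [← CStarRing.star_mul_self_eq_zero_iff, star_mul,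
    show star z * star y * (y * z) = star z * (star y * y) * z by noncomm_ring, ← h,
    show star z * (star x * x) * z = star z * star x * (x * z) by noncomm_ring, hx, mul_zero]

lemma mul_eq_zero_of_star_mul_mul {x z : A} (h : star x * (x * z) = 0) : x * z = 0 := by
  rw [← CStarRing.star_mul_self_eq_zero_iff, star_mul, mul_assoc, h, mul_zero]

lemma star_mul_eq_zero {a b : A} (h : a * b = 0) : star b * star a = 0 := by
  rw [← star_mul, h, star_zero]

lemma star_mul_eq {a b c : A} (h : a * b = c) : star b * star a = star c := by
  rw [← star_mul, h]

namespace IsProjection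

variable {p q : A}

lemma zero : IsProjection (0 : A) := ⟨star_zero _, mul_zero _⟩

lemma mul_star_mul_self {v : A} (h : IsProjection (star v * v)) : v * (star v * v) = v := by
  rw [← sub_eq_zero, ← CStarRing.star_mul_self_eq_zero_iff]
  have := h.2
  simp only [star_sub, star_mul, star_star, sub_mul, mul_sub]
  grind

lemma mul_star {v : A} (h : IsProjection (star v * v)) : IsProjection (v * star v) := by
  refine ⟨by simp, ?_⟩
  have := h.mul_star_mul_self
  grind

lemma norm_le_one_of_star_mul_self {v : A} (h : IsProjection (star v * v)) : ‖v‖ ≤ 1 := by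
  have h1 : ‖star v * v‖ = ‖star v * v‖ * ‖star v * v‖ := by
    conv_lhs => rw [← h.2]
    nth_rewrite 1 [← h.1]
    rw [CStarRing.norm_star_mul_self]
  rw [CStarRing.norm_star_mul_self] at h1
  by_contra! hv
  nlinarith [mul_pos (sub_pos.2 hv) (sub_pos.2 hv)]

lemma star_mul_self (h : IsProjection p) : star p * p = p := by rw [h.1, h.2]

lemma swap_mul_eq_zero (hp : IsProjection p) (hq : IsProjection q) (h : p * q = 0) :
    q * p = 0 := by
  have := star_mul_eq_zero h
  rwa [hp.1, hq.1] at this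

lemma swap_mul_eq_left (hp : IsProjection p) (hq : IsProjection q) (h : p * q = p) :
    q * p = p := by
  have := star_mul_eq h
  rwa [hp.1, hq.1] at this

lemma swap_mul_eq_right (hp : IsProjection p) (hq : IsProjection q) (h : p * q = q) :
    q * p = q := by
  have := star_mul_eq h
  rwa [hp.1, hq.1] at this

lemma mul (hp : IsProjection p) (hq : IsProjection q) (h : p * q = q * p) :
    IsProjection (p * q) := by
  refine ⟨by rw [star_mul, hp.1, hq.1, h], ?_⟩
  have := hp.2
  have := hq.2
  grind

lemma sub (hp : IsProjection p) (hq : IsProjection q) (h : q * p = q) :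
    IsProjection (p - q) := by
  refine ⟨by rw [star_sub, hp.1, hq.1], ?_⟩
  rw [mul_sub, sub_mul, sub_mul, hp.2, hq.2, h, hq.swap_mul_eq_left hp h]
  abel

lemma commute_of_mul_mul_eq {T : A} (hp : IsProjection p) (hT : star T = T)
    (h : p * (T * p) = T * p) : T * p = p * T := by
  have := star_mul_eq h
  simp only [star_mul, hp.1, hT] at this
  rw [← h, ← this, mul_assoc]

end IsProjection

namespace IsARP

variable {x p q w z : A}

lemma mul_eq_zero_iff (h : IsARP x p) : x * z = 0 ↔ p * z = 0 :=
  ⟨h.2.2 z, fun hz => by rw [← h.2.1, mul_assoc, hz, mul_zero]⟩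

lemma mul_eq_mul_iff (h : IsARP x p) {y : A} : x * y = x * z ↔ p * y = p * z := by
  rw [← sub_eq_zero, ← mul_sub, h.mul_eq_zero_iff, mul_sub, sub_eq_zero]

lemma mul_eq_of_mul_eq (h : IsARP x p) (hq : x * q = x) : p * q = p :=
  sub_mul_eq_zero_of_forall fun z => by
    rw [mul_assoc, ← h.mul_eq_mul_iff, ← mul_assoc, hq]

lemma self_mul (h : IsARP w p) (hw : star w = w) : p * w = w := by
  have := star_mul_eq h.2.1
  rwa [h.1.1, hw] at this

lemma mul_right_eq_zero (h : IsARP w p) (hw : star w = w) (hz : z * w = 0) : z * p = 0 := by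
  have h1 := star_mul_eq_zero hz
  rw [hw] at h1
  have := star_mul_eq_zero (h.2.2 _ h1)
  rwa [star_star, h.1.1] at this

lemma mul_right_eq (h : IsARP w p) (hw : star w = w) {y : A} (hz : z * w = y * w) :
    z * p = y * p := by
  rw [← sub_eq_zero, ← sub_mul] at hz ⊢
  exact h.mul_right_eq_zero hw hz

lemma commute (h : IsARP w p) {T : A} (hT : star T = T) (hwT : w * T = T * w) :
    T * p = p * T := by
  refine h.1.commute_of_mul_mul_eq hT ?_
  have h1 : w * (T * p) = w * T := by
    rw [← mul_assoc, hwT, mul_assoc, h.2.1]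
  have h2 := star_mul_eq (h.mul_eq_mul_iff.1 h1)
  simpa only [star_mul, h.1.1, hT, mul_assoc] using h2

end IsARP

end Basics

section PolarFactor

variable {A : Type*} [NonUnitalCStarAlgebra A]

lemma WeaklyRickart.exists_mul_eq (hA : WeaklyRickart A) {k y : A} (hk : star k = k)
    (hky : k * y = 0) (hy : star y * y = k * k) : ∃ s, s * k = y := by
  obtain ⟨G, hG⟩ := hA (star (k + y))
  obtain ⟨G', hG'⟩ := hA (star (k - y))
  have hky' := star_mul_eq_zero hky
  rw [hk] at hky'
  have h1 : G * (k + y) = k + y := by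
    simpa only [star_mul, star_star, hG.1.1] using star_mul_eq hG.2.1
  have h2 : G' * (k - y) = k - y := by
    simpa only [star_mul, star_star, hG'.1.1] using star_mul_eq hG'.2.1
  have h3 : G * (k - y) = 0 := by
    refine hG.2.2 _ ?_
    simp only [star_add, hk, add_mul, mul_sub, hky, hky', hy]
    abel
  have h4 : G' * (k + y) = 0 := by
    refine hG'.2.2 _ ?_
    simp only [star_sub, hk, sub_mul, mul_add, hky, hky', hy]
    abel
  refine ⟨G - G', ?_⟩
  have h5 : (2 : ℂ) • ((G - G') * k) = (2 : ℂ) • y := by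
    calc (2 : ℂ) • ((G - G') * k)
        = G * (k + y) + G * (k - y) - (G' * (k - y) + G' * (k + y)) := by
          rw [two_smul]; noncomm_ring
      _ = (2 : ℂ) • y := by rw [h1, h2, h3, h4, two_smul]; abel
  exact smul_right_injective A two_ne_zero h5

lemma WeaklyRickart.exists_partialIsometry (hA : WeaklyRickart A) {k y X : A} (hk : star k = k)
    (hX : IsARP k X) (hky : k * y = 0) (hy : star y * y = k * k) :
    ∃ V, star V * V = X ∧ V * k = y ∧ V * X = V := by
  obtain ⟨s, hs⟩ := hA.exists_mul_eq hk hky hy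
  have hXk := hX.self_mul hk
  refine ⟨s * X, ?_, by rw [mul_assoc, hXk, hs], by rw [mul_assoc, hX.1.2]⟩
  have h1 : k * (star s * s * k) = k * k := by
    rw [← hy, ← hs, star_mul, hk]; noncomm_ring
  have h2 : X * (star s * s) * X = X * X := by
    refine hX.mul_right_eq hk ?_
    rw [mul_assoc]
    exact hX.mul_eq_mul_iff.1 h1
  calc star (s * X) * (s * X) = X * (star s * s) * X := by
        rw [star_mul, hX.1.1]; noncomm_ring
    _ = X := by rw [h2, hX.1.2]

end PolarFactor

section Order

variable {A : Type*} [NonUnitalCStarAlgebra A] [PartialOrder A] [StarOrderedRing A]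

lemma mul_eq_zero_of_star_mul_self_le {b k z : A} (h : star b * b ≤ star k * k) (hz : k * z = 0) :
    b * z = 0 := by
  rw [← CStarRing.star_mul_self_eq_zero_iff]
  refine le_antisymm ?_ (star_mul_self_nonneg _)
  calc star (b * z) * (b * z) = star z * (star b * b) * z := by rw [star_mul]; noncomm_ring
    _ ≤ star z * (star k * k) * z := star_left_conjugate_le_conjugate h z
    _ = star z * star k * (k * z) := by noncomm_ring
    _ = 0 := by rw [hz, mul_zero]

lemma mul_eq_of_star_mul_self_le {b k X : A} (h : star b * b ≤ star k * k) (hX : k * X = k) :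
    b * X = b :=
  sub_mul_eq_zero_of_forall fun z => by
    have : k * (X * z - z) = 0 := by rw [mul_sub, ← mul_assoc, hX, sub_self]
    have := mul_eq_zero_of_star_mul_self_le h this
    rwa [mul_sub, sub_eq_zero, ← mul_assoc] at this

lemma star_mul_self_mul_le {b k X : A} (h : star b * b ≤ star k * k) :
    star (b * X) * (b * X) ≤ star (k * X) * (k * X) := by
  have := star_left_conjugate_le_conjugate h X
  simpa only [star_mul, mul_assoc] using this

lemma star_mul_self_projection_mul_le {p b : A} (hp : IsProjection p) :
    star (p * b) * (p * b) ≤ star b * b := by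
  rw [← sub_nonneg]
  have := star_mul_self_nonneg (b - p * b)
  have h : star (b - p * b) * (b - p * b) = star b * b - star (p * b) * (p * b) := by
    have := hp.2
    simp only [star_sub, star_mul, hp.1, sub_mul, mul_sub]
    have : star b * p * (p * b) = star b * p * b := by grind
    rw [this]
    simp only [mul_assoc]
    abel
  rwa [h] at this

/-- Sign decomposition of a self-adjoint element. -/
lemma WeaklyRickart.exists_sign (hA : WeaklyRickart A) {a : A} (ha : star a = a) :
    ∃ s, ‖s‖ ≤ 1 ∧ a = s * CFC.abs a := by
  obtain ⟨P, hP⟩ := hA a⁺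
  obtain ⟨Q, hQ⟩ := hA a⁻
  have hpos : star a⁺ = a⁺ := (CFC.posPart_nonneg a).isSelfAdjoint
  have hneg : star a⁻ = a⁻ := (CFC.negPart_nonneg a).isSelfAdjoint
  have h1 := hP.self_mul hpos
  have h2 := hQ.self_mul hneg
  have h3 : P * a⁻ = 0 := hP.2.2 _ (CFC.posPart_mul_negPart a)
  have h4 : Q * a⁺ = 0 := hQ.2.2 _ (CFC.negPart_mul_posPart a)
  have h5 : P * Q = 0 := hQ.mul_right_eq_zero hneg h3
  have h6 : Q * P = 0 := hP.1.swap_mul_eq_zero hQ.1 h5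
  refine ⟨P - Q, IsProjection.norm_le_one_of_star_mul_self ?_, ?_⟩
  · have : star (P - Q) * (P - Q) = P + Q := by
      rw [star_sub, hP.1.1, hQ.1.1, sub_mul, mul_sub, mul_sub, h5, h6, hP.1.2, hQ.1.2]; abel
    rw [this]
    refine ⟨by rw [star_add, hP.1.1, hQ.1.1], ?_⟩
    rw [add_mul, mul_add, mul_add, h5, h6, hP.1.2, hQ.1.2, zero_add, add_zero]
  rw [← CFC.posPart_add_negPart a ha, sub_mul, mul_add, mul_add, h1, h2, h3, h4, zero_add,
    add_zero, CFC.posPart_sub_negPart a ha]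

lemma abs_le_of_commute {a k : A} (hk : 0 ≤ k) (ha : star a = a) (hc : Commute a k)
    (h1 : -k ≤ a) (h2 : a ≤ k) : CFC.abs a ≤ k := by
  have h : star a * a ≤ star k * k := by
    rw [ha, hk.isSelfAdjoint.star_eq, ← sub_nonneg]
    have h3 : 0 ≤ (k - a) * (k + a) := by
      refine Commute.mul_nonneg (sub_nonneg.2 h2) ?_
        (((Commute.refl k).add_right hc.symm).sub_left (hc.add_right (Commute.refl a)))
      rwa [← sub_neg_eq_add, sub_nonneg, ← neg_le]
    have : (k - a) * (k + a) = k * k - a * a := by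
      rw [sub_mul, mul_add, mul_add, hc.eq]; abel
    rwa [this] at h3
  calc CFC.abs a = CFC.sqrt (star a * a) := rfl
    _ ≤ CFC.sqrt (star k * k) := CFC.sqrt_le_sqrt _ _ h
    _ = k := by rw [hk.isSelfAdjoint.star_eq]; exact CFC.sqrt_mul_self k hk

lemma WeaklyRickart.exists_sign_step (hA : WeaklyRickart A) {k : A} (hk : 0 ≤ k) (a : A)
    (ha : star a = a ∧ Commute a k ∧ -k ≤ a ∧ a ≤ k) :
    ∃ s a', ‖s‖ ≤ 1 ∧ (star a' = a' ∧ Commute a' k ∧ -k ≤ a' ∧ a' ≤ k) ∧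
      a = (2⁻¹ : ℝ) • (s * k + s * a') := by
  obtain ⟨ha, hc, h1, h2⟩ := ha
  obtain ⟨s, hs, hs'⟩ := hA.exists_sign ha
  have hle := abs_le_of_commute hk ha hc h1 h2
  have h0 := CFC.abs_nonneg a
  refine ⟨s, CFC.abs a + CFC.abs a - k, hs, ⟨?_, ?_, ?_, ?_⟩, ?_⟩
  · rw [star_sub, star_add, h0.isSelfAdjoint.star_eq, hk.isSelfAdjoint.star_eq]
  · have := Commute.cfcAbs_left hc (by rwa [hk.isSelfAdjoint.star_eq])
    exact (this.add_left this).sub_left (Commute.refl k)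
  · rw [neg_le_sub_iff_le_add, ← sub_nonneg, add_sub_cancel_right]
    exact add_nonneg h0 h0
  · rw [sub_le_iff_le_add]
    exact add_le_add hle hle
  · rw [← mul_add, add_sub_cancel, mul_add, ← hs', ← two_smul ℝ a, smul_smul]
    norm_num

lemma WeaklyRickart.exists_eq_mul_of_le (hA : WeaklyRickart A) {k a : A} (hk : 0 ≤ k)
    (ha : star a = a) (hc : Commute a k) (h1 : -k ≤ a) (h2 : a ≤ k) : ∃ t, a = t * k := by
  choose! s nxt hs hn hstep using hA.exists_sign_step hk
  let b : ℕ → A := fun n => nxt^[n] a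
  have hb : ∀ n, star (b n) = b n ∧ Commute (b n) k ∧ -k ≤ b n ∧ b n ≤ k := by
    intro n
    induction n with
    | zero => exact ⟨ha, hc, h1, h2⟩
    | succ n ih =>
      have : b (n + 1) = nxt (b n) := Function.iterate_succ_apply' nxt n a
      rw [this]
      exact hn _ ih
  have hb' : ∀ n, b n = (2⁻¹ : ℝ) • (s (b n) * k + s (b n) * b (n + 1)) := by
    intro n
    have : b (n + 1) = nxt (b n) := Function.iterate_succ_apply' nxt n a
    rw [this]
    exact hstep _ (hb n)
  have hbn : ∀ n, ‖b n‖ ≤ ‖k‖ := by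
    intro n
    obtain ⟨e1, e2, e3, e4⟩ := hb n
    rw [← CFC.norm_abs (a := b n)]
    exact CStarAlgebra.norm_le_norm_of_nonneg_of_le (CFC.abs_nonneg _)
      (abs_le_of_commute hk e1 e2 e3 e4)
  let S : ℕ → A := Nat.rec (s (b 0)) fun n x => x * s (b (n + 1))
  have hS : ∀ n, S (n + 1) = S n * s (b (n + 1)) := fun n => rfl
  have hSn : ∀ n, ‖S n‖ ≤ 1 := by
    intro n
    induction n with
    | zero => exact hs _ (hb 0)
    | succ n ih =>
      rw [hS]
      exact (norm_mul_le _ _).trans (mul_le_one₀ ih (norm_nonneg _) (hs _ (hb _)))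
  let f : ℕ → A := fun n => ((2⁻¹ : ℝ) ^ (n + 1)) • S n
  have hf : ∀ n, ‖f n‖ ≤ (2⁻¹ : ℝ) ^ (n + 1) := by
    intro n
    rw [norm_smul, norm_pow, Real.norm_of_nonneg (by norm_num)]
    exact mul_le_of_le_one_right (by positivity) (hSn n)
  have hgeo : Summable fun n : ℕ => (2⁻¹ : ℝ) ^ (n + 1) :=
    (summable_nat_add_iff 1).2 (summable_geometric_of_lt_one (by norm_num) (by norm_num))
  have hsum : Summable f := Summable.of_norm_bounded hgeo hf
  have key : ∀ n, a = (∑ i ∈ Finset.range (n + 1), f i) * k + f n * b (n + 1) := by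
    intro n
    induction n with
    | zero =>
      have := hb' 0
      simp only [zero_add, Finset.range_one, Finset.sum_singleton, f, pow_one, smul_mul_assoc]
      rw [← smul_add]
      exact this
    | succ n ih =>
      rw [Finset.sum_range_succ, add_mul, add_assoc]
      refine ih.trans ?_
      congr 1
      conv_lhs => rw [hb' (n + 1)]
      simp only [f, hS, smul_mul_assoc, mul_smul_comm, ← smul_add, smul_smul, mul_add, mul_assoc]
      congr 1
      ring
  refine ⟨∑' n, f n, ?_⟩
  have hlim1 : Filter.Tendsto (fun n => (∑ i ∈ Finset.range (n + 1), f i) * k) Filter.atTop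
      (nhds ((∑' n, f n) * k)) :=
    ((Filter.tendsto_add_atTop_iff_nat 1).2 hsum.hasSum.tendsto_sum_nat).mul_const k
  have hlim2 : Filter.Tendsto (fun n => f n * b (n + 1)) Filter.atTop (nhds 0) := by
    refine squeeze_zero_norm (a := fun n => (2⁻¹ : ℝ) ^ (n + 1) * ‖k‖) (fun n => ?_) ?_
    · exact (norm_mul_le _ _).trans (mul_le_mul (hf n) (hbn _) (norm_nonneg _) (by positivity))
    · simpa using hgeo.tendsto_atTop_zero.mul_const ‖k‖
  have := hlim1.add hlim2
  simp only [← key, add_zero] at this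
  exact tendsto_nhds_unique tendsto_const_nhds this

lemma WeaklyRickart.exists_add_star_eq_mul (hA : WeaklyRickart A) {k b : A} (hk : 0 ≤ k)
    (hc : Commute b k) (h : star b * b ≤ k * k) : ∃ t, b + star b = t * k := by
  obtain ⟨R, hR⟩ := hA k
  have hks := hk.isSelfAdjoint.star_eq
  have hc' : Commute (star b) k := by
    have := hc.star_star
    rwa [hks] at this
  have hRk := hR.self_mul hks
  have hbR : b * R = b := mul_eq_of_star_mul_self_le (by rwa [hks]) hR.2.1
  have hRb : R * b = b := by
    have : R * b * R = b * R := by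
      refine hR.mul_right_eq hks ?_
      rw [mul_assoc, hc.eq, ← mul_assoc, hRk]
    rwa [mul_assoc, hbR] at this
  have hsbR : star b * R = star b := by
    simpa only [hR.1.1] using star_mul_eq hRb
  have e1 : k * (b + star b) ≤ k * k + k * k := by
    rw [← sub_nonneg]
    have : k * k + k * k - k * (b + star b) =
        star (k - b) * (k - b) + (k * k - star b * b) := by
      simp only [star_sub, hks, sub_mul, mul_sub, mul_add, hc'.eq]
      abel
    rw [this]
    exact add_nonneg (star_mul_self_nonneg _) (sub_nonneg.2 h)
  have e2 : -(k * k + k * k) ≤ k * (b + star b) := by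
    rw [← sub_nonneg]
    have : k * (b + star b) - -(k * k + k * k) =
        star (k + b) * (k + b) + (k * k - star b * b) := by
      simp only [star_add, hks, add_mul, mul_add, hc'.eq]
      abel
    rw [this]
    exact add_nonneg (star_mul_self_nonneg _) (sub_nonneg.2 h)
  have hkk : 0 ≤ k * k := Commute.mul_nonneg hk hk (Commute.refl k)
  have hcs : Commute (b + star b) k := hc.add_left hc'
  obtain ⟨t, ht⟩ := hA.exists_eq_mul_of_le (add_nonneg hkk hkk) (a := k * (b + star b))
    (by rw [star_mul, hks, star_add, star_star, add_comm, hcs.eq])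
    ((((Commute.refl k).mul_left hcs).mul_right ((Commute.refl k).mul_left hcs)).add_right
      (((Commute.refl k).mul_left hcs).mul_right ((Commute.refl k).mul_left hcs))) e2 e1
  refine ⟨t + t, ?_⟩
  have : (b + star b) * R = (t + t) * k * R := by
    refine hR.mul_right_eq hks ?_
    rw [hcs.eq, ht]; noncomm_ring
  rwa [add_mul, hbR, hsbR, mul_assoc, hR.2.1] at this

lemma WeaklyRickart.exists_eq_mul_of_commute (hA : WeaklyRickart A) {k b : A} (hk : 0 ≤ k)
    (hc : Commute b k) (h : star b * b ≤ k * k) : ∃ t, b = t * k := by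
  obtain ⟨t, ht⟩ := hA.exists_add_star_eq_mul hk hc h
  obtain ⟨t', ht'⟩ := hA.exists_add_star_eq_mul (b := Complex.I • b) hk (hc.smul_left _) (by
    rw [star_smul, smul_mul_smul_comm]
    simpa using h)
  refine ⟨(2⁻¹ : ℂ) • (t - Complex.I • t'), ?_⟩
  rw [smul_mul_assoc, sub_mul, smul_mul_assoc, ← ht, ← ht', star_smul, smul_add, smul_smul,
    smul_smul]
  simp only [Complex.I_mul_I, Complex.star_def, Complex.conj_I, mul_neg, neg_neg, one_smul,
    neg_smul]
  rw [show b + star b - (-b + star b) = (2 : ℂ) • b by rw [two_smul]; abel, smul_smul]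
  norm_num

end Order

section PowSum

variable {A : Type*} [NonUnitalCStarAlgebra A]

lemma summable_pow_smul {v : ℕ → A} (hv : ∀ i, IsProjection (star (v i) * v i)) :
    Summable fun i => (2⁻¹ : ℝ) ^ i • v i := by
  refine Summable.of_norm_bounded
    (summable_geometric_of_lt_one (r := (2⁻¹ : ℝ)) (by norm_num) (by norm_num)) fun i => ?_
  rw [norm_smul, norm_pow, Real.norm_of_nonneg (by norm_num)]
  exact mul_le_of_le_one_right (by positivity) (hv i).norm_le_one_of_star_mul_self

lemma mul_tsum_pow_smul {v : ℕ → A} (hv : ∀ i, IsProjection (star (v i) * v i)) {d : A} {j : ℕ}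
    (hd : ∀ i, i ≠ j → d * v i = 0) :
    d * ∑' i, (2⁻¹ : ℝ) ^ i • v i = (2⁻¹ : ℝ) ^ j • (d * v j) := by
  rw [← (summable_pow_smul hv).tsum_mul_left, tsum_eq_single j, mul_smul_comm]
  intro i hi
  rw [mul_smul_comm, hd i hi, smul_zero]

lemma tsum_pow_smul_mul {v : ℕ → A} (hv : ∀ i, IsProjection (star (v i) * v i)) {d : A} {j : ℕ}
    (hd : ∀ i, i ≠ j → v i * d = 0) :
    (∑' i, (2⁻¹ : ℝ) ^ i • v i) * d = (2⁻¹ : ℝ) ^ j • (v j * d) := by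
  rw [← (summable_pow_smul hv).tsum_mul_right, tsum_eq_single j, smul_mul_assoc]
  intro i hi
  rw [smul_mul_assoc, hd i hi, smul_zero]

end PowSum

section Diagonal

variable {A : Type*} [NonUnitalCStarAlgebra A] [PartialOrder A] [StarOrderedRing A]

/-- A positive element that is diagonal with respect to a sequence of orthogonal projections
exhausting its support. -/
structure IsDiagonalOn (k : A) (g : ℕ → A) (c : ℕ → ℝ) : Prop where
  nonneg : 0 ≤ k
  proj : ∀ n, IsProjection (g n)
  orth : ∀ n m, n ≠ m → g n * g m = 0
  left : ∀ n, g n * k = c n • g n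
  faithful : ∀ z, (∀ n, g n * z = 0) → k * z = 0

namespace IsDiagonalOn

variable {k R : A} {g : ℕ → A} {c : ℕ → ℝ}

lemma star_eq (h : IsDiagonalOn k g c) : star k = k := h.nonneg.isSelfAdjoint.star_eq

lemma right (h : IsDiagonalOn k g c) (n : ℕ) : k * g n = c n • g n := by
  have := star_mul_eq (h.left n)
  simpa [h.star_eq, (h.proj n).1] using this

lemma mul_mul_eq_zero (h : IsDiagonalOn k g c) {w : A} (hw : ∀ n m, g n * w * g m = 0) :
    k * w * k = 0 := by
  have h1 : ∀ m, k * (w * g m) = 0 := fun m =>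
    h.faithful _ fun n => by rw [← mul_assoc, hw]
  have h2 : k * (star w * k) = 0 := by
    refine h.faithful _ fun m => ?_
    have := star_mul_eq_zero (h1 m)
    rwa [star_mul, (h.proj m).1, h.star_eq, mul_assoc] at this
  have := star_mul_eq_zero h2
  rwa [star_mul, star_star, h.star_eq] at this

lemma commute_of_offDiag (h : IsDiagonalOn k g c) (hR : IsARP k R) {T : A} (h1 : R * T = T)
    (h2 : T * R = T) (hT : ∀ n m, n ≠ m → g n * T * g m = 0) : T * k = k * T := by
  have hRk := hR.self_mul h.star_eq
  have h3 : k * (T * k - k * T) * k = 0 := by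
    refine h.mul_mul_eq_zero fun n m => ?_
    have : g n * (T * k - k * T) * g m = g n * T * (k * g m) - g n * k * T * g m := by
      noncomm_ring
    rw [this, h.left, h.right, mul_smul_comm, smul_mul_assoc, smul_mul_assoc]
    rcases eq_or_ne n m with rfl | hnm
    · rw [sub_self]
    · rw [hT n m hnm, smul_zero, smul_zero, sub_zero]
  have h4 := hR.mul_right_eq_zero h.star_eq h3
  rw [mul_assoc, hR.mul_eq_zero_iff, sub_mul, mul_assoc, hR.2.1, mul_assoc, h2, mul_sub,
    ← mul_assoc, ← mul_assoc, h1, hRk, sub_eq_zero] at h4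
  exact h4

lemma commute_of_forall_commute (h : IsDiagonalOn k g c) (hR : IsARP k R) {T : A} (h1 : R * T = T)
    (h2 : T * R = T) (hT : ∀ n, g n * T = T * g n) : T * k = k * T :=
  h.commute_of_offDiag hR h1 h2 fun n m hnm => by
    rw [hT, mul_assoc, h.orth n m hnm, mul_zero]

lemma mul_proj (h : IsDiagonalOn k g c) {X : A} (hX : IsProjection X) (hk : X * k = k * X)
    (hg : ∀ n, g n * X = X * g n) : IsDiagonalOn (k * X) (fun n => g n * X) c where
  nonneg := by
    have : k * X = star X * k * X := by rw [hX.1, hk, mul_assoc, hX.2]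
    rw [this]
    exact star_left_conjugate_nonneg h.nonneg X
  proj n := (h.proj n).mul hX (hg n)
  orth n m hnm := by
    rw [mul_assoc, ← mul_assoc X, ← hg m, mul_assoc, hX.2, ← mul_assoc, h.orth n m hnm, zero_mul]
  left n := by
    rw [mul_assoc, ← mul_assoc X, hk, mul_assoc, hX.2, ← mul_assoc, h.left, smul_mul_assoc]
  faithful z hz := by
    rw [mul_assoc]
    exact h.faithful _ fun n => by rw [← mul_assoc, hz n]

end IsDiagonalOn

lemma exists_isDiagonalOn_of_orthogonal {v X : ℕ → A} (hX : ∀ i, IsProjection (X i))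
    (hXX : ∀ i j, i ≠ j → X i * X j = 0) (hv : ∀ i, star (v i) * v i = X i)
    (hvv : ∀ i j, i ≠ j → star (v i) * v j = 0) :
    ∃ w y, IsDiagonalOn w X (fun n => (2⁻¹ : ℝ) ^ n) ∧ star y * y = w * w ∧
      (∀ j, y * X j = (2⁻¹ : ℝ) ^ j • v j) ∧ ∀ d, (∀ j, d * v j = 0) → d * y = 0 := by
  have hX' : ∀ i, IsProjection (star (X i) * X i) := fun i => by
    rw [(hX i).star_mul_self]; exact hX i
  have hv' : ∀ i, IsProjection (star (v i) * v i) := fun i => by rw [hv]; exact hX i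
  have hvX : ∀ i, v i * X i = v i := fun i => by rw [← hv, (hv' i).mul_star_mul_self]
  have hvX' : ∀ j i, i ≠ j → v i * X j = 0 := fun j i hij => by
    rw [← hvX i, mul_assoc, hXX i j hij, mul_zero]
  have hw : ∀ j, X j * ∑' i, (2⁻¹ : ℝ) ^ i • X i = (2⁻¹ : ℝ) ^ j • X j := fun j => by
    rw [mul_tsum_pow_smul hX' (fun i hi => hXX j i hi.symm), (hX j).2]
  have hw' : ∀ j, (∑' i, (2⁻¹ : ℝ) ^ i • X i) * X j = (2⁻¹ : ℝ) ^ j • X j := fun j => by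
    rw [tsum_pow_smul_mul hX' (fun i hi => hXX i j hi), (hX j).2]
  have hy : ∀ j, star (v j) * ∑' i, (2⁻¹ : ℝ) ^ i • v i = (2⁻¹ : ℝ) ^ j • X j := fun j => by
    rw [mul_tsum_pow_smul hv' (fun i hi => hvv j i hi.symm), hv]
  have hy' : ∀ j, star (∑' i, (2⁻¹ : ℝ) ^ i • v i) * v j = (2⁻¹ : ℝ) ^ j • X j := fun j => by
    simpa [(hX j).1] using star_mul_eq (hy j)
  refine ⟨∑' i, (2⁻¹ : ℝ) ^ i • X i, ∑' i, (2⁻¹ : ℝ) ^ i • v i,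
    ⟨tsum_nonneg fun i => smul_nonneg (by positivity) ?_, hX, hXX, hw, fun z hz => ?_⟩,
    ?_, fun j => ?_, fun d hd => ?_⟩
  · rw [← (hX i).star_mul_self]
    exact star_mul_self_nonneg _
  · rw [tsum_pow_smul_mul hX' (j := 0) fun i _ => hz i, hz, smul_zero]
  · conv_lhs => rw [← (summable_pow_smul hv').tsum_mul_left]
    conv_rhs => rw [← (summable_pow_smul hX').tsum_mul_left]
    simp only [mul_smul_comm, hy', hw']
  · rw [tsum_pow_smul_mul hv' (hvX' j), hvX]
  · rw [mul_tsum_pow_smul hv' (j := 0) fun i _ => hd i, hd, smul_zero]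

lemma WeaklyRickart.exists_sup (hA : WeaklyRickart A) {v : ℕ → A}
    (hX : ∀ i, IsProjection (star (v i) * v i)) (hvv : ∀ i j, i ≠ j → star (v i) * v j = 0)
    (hvv' : ∀ i j, i ≠ j → v i * star (v j) = 0) (h0 : ∀ i j, v i * v j = 0) :
    ∃ V, IsProjection (star V * V) ∧ V * V = 0 ∧ (∀ i, V * (star (v i) * v i) = v i) ∧
      (∀ i, star V * V * (star (v i) * v i) = star (v i) * v i) ∧
      ∀ z, (∀ i, star (v i) * v i * z = 0) → V * z = 0 := by
  obtain ⟨w, y, hw, hyw, hyX, hd⟩ := exists_isDiagonalOn_of_orthogonal hX (fun i j hij => by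
    rw [mul_assoc, ← mul_assoc (v i), hvv' i j hij, zero_mul, mul_zero]) (fun i => rfl) hvv
  obtain ⟨X, hXw⟩ := hA w
  have hwy : w * y = 0 := hw.faithful _ fun i => hd _ fun j => by
    rw [mul_assoc, h0, mul_zero]
  obtain ⟨V, hV, hVw, hVX⟩ := hA.exists_partialIsometry hw.star_eq hXw hwy hyw
  have hVv : ∀ i, V * (star (v i) * v i) = v i := fun j => by
    have h1 := hyX j
    rw [← hVw, mul_assoc, hw.right, mul_smul_comm] at h1
    exact smul_right_injective A (pow_ne_zero j (by norm_num : (2⁻¹ : ℝ) ≠ 0)) h1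
  have hfaith : ∀ z, (∀ i, star (v i) * v i * z = 0) → X * z = 0 := fun z hz =>
    hXw.2.2 _ (hw.faithful z hz)
  refine ⟨V, hV ▸ hXw.1, ?_, hVv, fun j => ?_, fun z hz => ?_⟩
  · have : X * V = 0 := by
      have h2 : ∀ j, star (v j) * v j * (star V * X) = 0 := fun j => by
        have h3 : X * (V * (star (v j) * v j)) = 0 := by
          rw [hVv]
          exact hfaith _ fun i => by rw [mul_assoc, h0, mul_zero]
        have := star_mul_eq_zero h3
        simp only [star_mul, star_star, hXw.1.1] at this
        rw [← mul_assoc]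
        exact this
      have h3 := star_mul_eq_zero (hfaith _ h2)
      rwa [star_mul, star_star, hXw.1.1, mul_assoc, hVX] at h3
    rw [← hVX, mul_assoc, ← mul_assoc X, this, zero_mul, mul_zero]
  · have h1 : (2⁻¹ : ℝ) ^ j • (star (v j) * v j * X) = (2⁻¹ : ℝ) ^ j • (star (v j) * v j) := by
      rw [← smul_mul_assoc, ← hw.left, mul_assoc, hXw.2.1]
    rw [hV]
    exact (hX j).swap_mul_eq_left hXw.1
      (smul_right_injective A (pow_ne_zero j (by norm_num : (2⁻¹ : ℝ) ≠ 0)) h1)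
  · rw [← hVX, mul_assoc, hfaith z hz, mul_zero]

end Diagonal

section RemoveRange

variable {A : Type*} [NonUnitalCStarAlgebra A]

lemma commute_star_mul_self_of_or {g v : A} (hg : star g = g) (h : v * g = v ∨ v * g = 0) :
    g * (star v * v) = star v * v * g := by
  rcases h with h | h
  · have := star_mul_eq h
    rw [hg] at this
    rw [← mul_assoc, this, mul_assoc, h]
  · have := star_mul_eq_zero h
    rw [hg] at this
    rw [← mul_assoc, this, mul_assoc, h, mul_zero, zero_mul]

lemma commute_mul_star_self_of_or {g v : A} (hg : star g = g) (h : g * v = v ∨ g * v = 0) :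
    g * (v * star v) = v * star v * g := by
  have := commute_star_mul_self_of_or (v := star v) hg (by
    rcases h with h | h
    · left
      simpa only [hg] using star_mul_eq h
    · right
      simpa only [hg] using star_mul_eq_zero h)
  simpa using this

/-- One removal step: subtract domain and range projections of `v` from `Z`. -/
lemma IsProjection.sub_star_mul_self_sub_mul_star_self {Z v : A}
    (hZ : IsProjection Z) (hv : IsProjection (star v * v))
    (hvv : v * v = 0) (hvZ : v * Z = v) (hZv : Z * v = v) :
    IsProjection (Z - star v * v - v * star v) ∧ v * (Z - star v * v - v * star v) = 0 ∧
      (Z - star v * v - v * star v) * v = 0 ∧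
      (Z - star v * v - v * star v) * Z = Z - star v * v - v * star v := by
  have h1 := hv.mul_star_mul_self
  have h2 := hZ.2
  have h3 := star_mul_eq hvZ
  have h4 := star_mul_eq hZv
  have h5 := star_mul_eq_zero hvv
  rw [hZ.1] at h3 h4
  have h6 : star v * v * Z = star v * v := by rw [mul_assoc, hvZ]
  have h7 : v * star v * Z = v * star v := by rw [mul_assoc, h4]
  have h8 : v * star v * (star v * v) = 0 := by
    rw [mul_assoc, ← mul_assoc (star v), h5, zero_mul, mul_zero]
  have hs : IsProjection (Z - star v * v) := hZ.sub hv h6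
  refine ⟨hs.sub hv.mul_star (by rw [mul_sub, h7, h8, sub_zero]), ?_, ?_, ?_⟩
  · rw [mul_sub, mul_sub, hvZ, h1, sub_self, ← mul_assoc, hvv, zero_mul, sub_zero]
  · rw [sub_mul, sub_mul, hZv, mul_assoc, hvv, mul_zero, sub_zero, mul_assoc, h1, sub_self]
  · rw [sub_mul, sub_mul, h2, h6, h7]

end RemoveRange

section Matching

variable {A : Type*} [NonUnitalCStarAlgebra A] [PartialOrder A] [StarOrderedRing A]

lemma WeaklyRickart.exists_polar_of_sq_zero (hA : WeaklyRickart A) {y q q' : A} (hy : y * y = 0)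
    (hq : y * q = y) (hq' : q' * y = y) :
    ∃ v, IsProjection (star v * v) ∧ y * (star v * v) = y ∧ v * q = v ∧ q' * v = v := by
  have hp := (CFC.abs_nonneg y).isSelfAdjoint.star_eq
  have hpp := CFC.abs_mul_abs y
  obtain ⟨X, hX⟩ := hA (CFC.abs y)
  have hpy : CFC.abs y * y = 0 := by
    refine mul_eq_zero_of_star_mul_self (x := y) ?_ hy
    rw [hp, hpp]
  obtain ⟨V, hV, hVp, hVX⟩ := hA.exists_partialIsometry hp hX hpy hpp.symm
  have hpq : CFC.abs y * q = CFC.abs y := sub_mul_eq_zero_of_forall fun z => by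
    have : CFC.abs y * (q * z - z) = 0 := by
      refine mul_eq_zero_of_star_mul_self (x := y) (by rw [hp, hpp]) ?_
      rw [mul_sub, ← mul_assoc, hq, sub_self]
    rw [mul_assoc, ← sub_eq_zero, ← mul_sub, this]
  refine ⟨V, hV ▸ hX.1, ?_, ?_, ?_⟩
  · rw [hV, ← hVp, mul_assoc, hX.2.1]
  · rw [← hVX, mul_assoc, hX.mul_eq_of_mul_eq hpq]
  · have : q' * V * X = V * X := hX.mul_right_eq hp (by rw [mul_assoc, hVp, hq'])
    rwa [mul_assoc, hVX] at this

lemma WeaklyRickart.exists_matching_step (hA : WeaklyRickart A) {k : A} {g : ℕ → A} {c : ℕ → ℝ}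
    (h : IsDiagonalOn k g c) (a Z : A) (n m : ℕ)
    (hZ : IsProjection Z ∧ ∀ l, g l * Z = Z * g l) :
    ∃ v, IsProjection (star v * v) ∧ v * v = 0 ∧ v * Z = v ∧ Z * v = v ∧
      (∀ l, g l * v = v ∨ g l * v = 0) ∧ (∀ l, v * g l = v ∨ v * g l = 0) ∧
      (n ≠ m → g n * Z * a * Z * g m * (star v * v) = g n * Z * a * Z * g m) := by
  rcases eq_or_ne n m with hnm | hnm
  · exact ⟨0, by simpa using IsProjection.zero, by simp, by simp, by simp, by simp, by simp,
      fun h => absurd hnm h⟩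
  have e1 := (h.proj n).2
  have e2 := (h.proj m).2
  have e3 := hZ.1.2
  have e4 := hZ.2 n
  have e5 := hZ.2 m
  have e6 := h.orth n m hnm
  have e7 := h.orth m n hnm.symm
  obtain ⟨v, hv, hyv, hvq, hqv⟩ := hA.exists_polar_of_sq_zero
    (y := g n * Z * a * Z * g m) (q := Z * g m) (q' := Z * g n)
    (by
      calc _ = g n * Z * a * Z * (g m * g n) * Z * a * Z * g m := by noncomm_ring
        _ = 0 := by rw [e7]; simp)
    (by grind) (by grind)
  have f1 : v * Z = v := by grind
  have f2 : v * g m = v := by grind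
  have f3 : Z * v = v := by grind
  have f4 : g n * v = v := by grind
  refine ⟨v, hv, ?_, f1, f3, fun l => ?_, fun l => ?_, fun _ => hyv⟩
  · rw [← f2, mul_assoc, ← mul_assoc (g m), ← f4, ← mul_assoc (g m), e7]
    simp
  · rcases eq_or_ne n l with rfl | hl
    · exact Or.inl f4
    · right
      rw [← f4, ← mul_assoc, h.orth l n hl.symm, zero_mul]
  · rcases eq_or_ne m l with rfl | hl
    · exact Or.inl f2
    · right
      rw [← f2, mul_assoc, h.orth m l hl, mul_zero]

lemma WeaklyRickart.exists_matching_seq (hA : WeaklyRickart A) {k R : A} {g : ℕ → A} {c : ℕ → ℝ}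
    (h : IsDiagonalOn k g c) (a : A) (hR : IsProjection R) (hRg : ∀ l, g l * R = R * g l) :
    ∃ Z v : ℕ → A, Z 0 = R ∧ (∀ i, Z (i + 1) = Z i - star (v i) * v i - v i * star (v i)) ∧
      (∀ i, IsProjection (Z i)) ∧ (∀ i l, g l * Z i = Z i * g l) ∧
      (∀ i, IsProjection (star (v i) * v i)) ∧ (∀ i, v i * v i = 0) ∧
      (∀ i, v i * Z i = v i) ∧ (∀ i, Z i * v i = v i) ∧
      (∀ i l, g l * v i = v i ∨ g l * v i = 0) ∧ (∀ i l, v i * g l = v i ∨ v i * g l = 0) ∧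
      ∀ n m, n ≠ m → ∃ i, g n * Z i * a * Z i * g m * (star (v i) * v i) =
        g n * Z i * a * Z i * g m := by
  choose! v hv1 hv2 hv3 hv4 hv5 hv6 hv7 using hA.exists_matching_step h a
  let u : ℕ → A → A := fun i Z => v Z i.unpair.1 i.unpair.2
  let Z : ℕ → A := Nat.rec R fun i Z => Z - star (u i Z) * u i Z - u i Z * star (u i Z)
  have hZ : ∀ i, IsProjection (Z i) ∧ ∀ l, g l * Z i = Z i * g l := by
    intro i
    induction i with
    | zero => exact ⟨hR, hRg⟩
    | succ i ih =>
      have e : Z (i + 1) = Z i - star (u i (Z i)) * u i (Z i) - u i (Z i) * star (u i (Z i)) := rfl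
      refine ⟨e ▸ (ih.1.sub_star_mul_self_sub_mul_star_self (hv1 _ _ _ ih) (hv2 _ _ _ ih)
        (hv3 _ _ _ ih) (hv4 _ _ _ ih)).1, fun l => ?_⟩
      rw [e, mul_sub, mul_sub, sub_mul, sub_mul, ih.2 l,
        commute_star_mul_self_of_or (h.proj l).1 (hv6 _ _ _ ih l),
        commute_mul_star_self_of_or (h.proj l).1 (hv5 _ _ _ ih l)]
  refine ⟨Z, fun i => u i (Z i), rfl, fun i => rfl, fun i => (hZ i).1, fun i => (hZ i).2,
    fun i => hv1 _ _ _ (hZ i), fun i => hv2 _ _ _ (hZ i), fun i => hv3 _ _ _ (hZ i),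
    fun i => hv4 _ _ _ (hZ i), fun i => hv5 _ _ _ (hZ i), fun i => hv6 _ _ _ (hZ i),
    fun n m hnm => ⟨Nat.pair n m, ?_⟩⟩
  have := hv7 (Z (Nat.pair n m)) n m (hZ _) hnm
  simpa only [u, Nat.unpair_pair] using this

/-- Maximal matching of off-diagonal entries: a diagonal element `k` is cut by three orthogonal
projections, two of which are equivalent, while the corner of `a` at the third commutes
with `k`. -/
lemma WeaklyRickart.exists_matching (hA : WeaklyRickart A) {k R : A} {g : ℕ → A} {c : ℕ → ℝ}
    (h : IsDiagonalOn k g c) (hR : IsARP k R) (a : A) :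
    ∃ v Z, IsProjection (star v * v) ∧ IsProjection Z ∧ v * v = 0 ∧
      star v * v + v * star v + Z = R ∧ v * Z = 0 ∧ Z * v = 0 ∧
      v * R = v ∧ R * v = v ∧ Z * R = Z ∧
      (∀ l, g l * (star v * v) = star v * v * g l) ∧
      (∀ l, g l * (v * star v) = v * star v * g l) ∧ (∀ l, g l * Z = Z * g l) ∧
      Z * a * Z * k = k * (Z * a * Z) := by
  have hRg : ∀ l, g l * R = R * g l := fun l =>
    hR.commute (h.proj l).1 (by rw [h.left, h.right])
  obtain ⟨Z, v, hZ0, hZs, hZ, hZg, hv, hvv, hvZ, hZv, hgv, hvg, hex⟩ :=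
    hA.exists_matching_seq h a hR.1 hRg
  have hstep : ∀ i, _ := fun i =>
    (hZ i).sub_star_mul_self_sub_mul_star_self (hv i) (hvv i) (hvZ i) (hZv i)
  simp only [← hZs] at hstep
  have hmono : ∀ i j, i ≤ j → Z j * Z i = Z j := by
    intro i j hij
    induction j, hij using Nat.le_induction with
    | base => exact (hZ i).2
    | succ j hij ih => rw [← (hstep j).2.2.2, mul_assoc, ih]
  have hmono' : ∀ i j, i ≤ j → Z i * Z j = Z j := fun i j hij =>
    (hZ j).swap_mul_eq_left (hZ i) (hmono i j hij)
  have hvZ0 : ∀ i j, i < j → v i * Z j = 0 := fun i j hij => by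
    rw [← hmono' (i + 1) j hij, ← mul_assoc, (hstep i).2.1, zero_mul]
  have hZv0 : ∀ i j, i < j → Z j * v i = 0 := fun i j hij => by
    rw [← hmono (i + 1) j hij, mul_assoc, (hstep i).2.2.1, mul_zero]
  have hv0 : ∀ i j, v i * v j = 0 := by
    intro i j
    rcases lt_trichotomy i j with hij | rfl | hij
    · rw [← hZv j, ← mul_assoc, hvZ0 i j hij, zero_mul]
    · exact hvv i
    · rw [← hvZ i, mul_assoc, hZv0 j i hij, mul_zero]
  have hsv : ∀ i j, i < j → star (v i) * v j = 0 := fun i j hij => by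
    have := star_mul_eq_zero (hZv0 i j hij)
    rw [(hZ j).1] at this
    rw [← hZv j, ← mul_assoc, this, zero_mul]
  have hvs : ∀ i j, i < j → v j * star (v i) = 0 := fun i j hij => by
    have := star_mul_eq_zero (hvZ0 i j hij)
    rw [(hZ j).1] at this
    rw [← hvZ j, mul_assoc, this, mul_zero]
  have hsv' : ∀ i j, i ≠ j → star (v i) * v j = 0 := fun i j hij => by
    rcases lt_or_gt_of_ne hij with hij | hij
    · exact hsv i j hij
    · simpa using star_mul_eq_zero (hsv j i hij)
  have hvs' : ∀ i j, i ≠ j → v i * star (v j) = 0 := fun i j hij => by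
    rcases lt_or_gt_of_ne hij with hij | hij
    · simpa using star_mul_eq_zero (hvs i j hij)
    · exact hvs j i hij
  obtain ⟨V, hV, hVV, hVv, hVX, hfaith⟩ := hA.exists_sup hv hsv' hvs' hv0
  have hfaith' : ∀ z, (∀ i, star (v i) * v i * star z = 0) → z * star V = 0 := fun z hz => by
    simpa using star_mul_eq_zero (hfaith _ hz)
  have hVs := hV.mul_star_mul_self
  have hvs1 : ∀ i, v i * (star (v i) * v i) = v i := fun i => (hv i).mul_star_mul_self
  have hright : ∀ y, (∀ i, y * (star (v i) * v i) = 0) → y * (star V * V) = 0 := fun y hy => by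
    rw [← mul_assoc, hfaith' y fun i => by
      have := star_mul_eq_zero (hy i)
      rwa [(hv i).1] at this, zero_mul]
  have hVR : R * V = V := by
    have := hright (R * V - V) fun i => by
      rw [sub_mul, mul_assoc, hVv, ← hZ0]
      nth_rewrite 1 [← hZv i]
      rw [← mul_assoc, hmono' 0 i (Nat.zero_le i), hZv, sub_self]
    rwa [sub_mul, mul_assoc, hVs, sub_eq_zero] at this
  have hRV : V * R = V := sub_mul_eq_zero_of_forall fun z => by
    have := hfaith (R * z - z) fun i => by
      have : v i * R = v i := by
        rw [← hZ0]
        nth_rewrite 1 [← hvZ i]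
        rw [mul_assoc, hmono 0 i (Nat.zero_le i), hvZ]
      rw [mul_sub, ← mul_assoc, mul_assoc (star (v i)), this, sub_self]
    rwa [mul_sub, sub_eq_zero, ← mul_assoc] at this
  have hVvi : ∀ i, V * v i = 0 := fun i => hfaith _ fun j => by
    rw [mul_assoc, hv0, mul_zero]
  have hviV : ∀ i, v i * V = 0 := fun i => by
    have := hright (v i * V) fun j => by rw [mul_assoc, hVv, hv0]
    rwa [mul_assoc, hVs] at this
  have hYv : ∀ i, V * star V * v i = v i := fun i => by
    calc V * star V * v i = V * star V * (V * (star (v i) * v i)) := by rw [hVv]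
      _ = V * (star V * V) * (star (v i) * v i) := by noncomm_ring
      _ = v i := by rw [hVs, hVv]
  have hgX : ∀ l, g l * (star V * V) = star V * V * g l := fun l => by
    refine hV.commute_of_mul_mul_eq (h.proj l).1 ?_
    have := hright (star V * V * g l - g l) fun i => by
      rw [sub_mul, mul_assoc, commute_star_mul_self_of_or (h.proj l).1 (hvg i l), ← mul_assoc,
        hVX, sub_self]
    rwa [sub_mul, sub_eq_zero, mul_assoc] at this
  have hgY : ∀ l, g l * (V * star V) = V * star V * g l := fun l => by
    refine hV.mul_star.commute_of_mul_mul_eq (h.proj l).1 ?_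
    have := hright (V * star V * g l * V - g l * V) fun i => by
      rw [sub_mul, mul_assoc, mul_assoc (g l), hVv, mul_assoc (V * star V)]
      rcases hgv i l with hl | hl
      · rw [hl, hYv, sub_self]
      · rw [hl, mul_zero, sub_self]
    rw [sub_mul, mul_assoc (V * star V * g l), mul_assoc (g l), hVs, sub_eq_zero] at this
    rw [← mul_assoc, ← mul_assoc, this, mul_assoc]
  obtain ⟨hW, hVW, hWV, hWR⟩ := hR.1.sub_star_mul_self_sub_mul_star_self hV hVV hRV hVR
  set W := R - star V * V - V * star V with hWdef
  have hWv : ∀ i, W * v i = 0 := fun i => by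
    have hRv : R * v i = v i := by
      rw [← hZ0]
      nth_rewrite 1 [← hZv i]
      rw [← mul_assoc, hmono' 0 i (Nat.zero_le i), hZv]
    rw [hWdef, sub_mul, sub_mul, hYv, hRv, mul_assoc, hVvi, mul_zero, sub_zero, sub_self]
  have hvW : ∀ i, v i * W = 0 := fun i => by
    have hvR : v i * R = v i := by
      rw [← hZ0]
      nth_rewrite 1 [← hvZ i]
      rw [mul_assoc, hmono 0 i (Nat.zero_le i), hvZ]
    have hvX : v i * (star V * V) = v i := by
      nth_rewrite 1 [← hvs1 i]
      rw [mul_assoc, hV.swap_mul_eq_right (hv i) (hVX i), hvs1]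
    rw [hWdef, mul_sub, mul_sub, hvR, hvX, sub_self, ← mul_assoc, hviV, zero_mul, sub_zero]
  have hWsv : ∀ i, W * star (v i) = 0 := fun i => by
    simpa [hW.1] using star_mul_eq_zero (hvW i)
  have hWZ : ∀ i, W * Z i = W := by
    intro i
    induction i with
    | zero => rw [hZ0, hWR]
    | succ i ih =>
      rw [hZs, mul_sub, mul_sub, ih, ← mul_assoc, hWsv, ← mul_assoc, hWv, zero_mul, zero_mul,
        sub_zero, sub_zero]
  have hZW : ∀ i, Z i * W = W := fun i => hW.swap_mul_eq_left (hZ i) (hWZ i)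
  have hRW : R * W = W := hW.swap_mul_eq_left hR.1 hWR
  have hgW : ∀ l, g l * W = W * g l := fun l => by
    rw [hWdef, mul_sub, mul_sub, sub_mul, sub_mul, hRg, hgX, hgY]
  refine ⟨V, W, hV, hW, hVV, ?_, hVW, hWV, hRV, hVR, hWR, hgX, hgY, hgW, ?_⟩
  · rw [hWdef]; abel
  refine h.commute_of_offDiag hR ?_ ?_ fun n m hnm => ?_
  · rw [← mul_assoc, ← mul_assoc, hRW]
  · rw [mul_assoc, hWR]
  · obtain ⟨i, hi⟩ := hex n m hnm
    have e1 : g n * Z i * a * Z i * g m * W = 0 := by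
      rw [← hi, mul_assoc, mul_assoc (star (v i)), hvW, mul_zero, mul_zero]
    calc g n * (W * a * W) * g m = g n * (W * Z i) * a * ((Z i * W) * g m) := by
          rw [hWZ, hZW]; noncomm_ring
      _ = (g n * W) * Z i * a * (Z i * (W * g m)) := by noncomm_ring
      _ = W * (g n * Z i * a * Z i * g m * W) := by rw [hgW, ← hgW m]; noncomm_ring
      _ = 0 := by rw [e1, mul_zero]

end Matching

section Douglas

variable {A : Type*} [NonUnitalCStarAlgebra A] [PartialOrder A] [StarOrderedRing A]

lemma WeaklyRickart.exists_eq_mul_of_partialIsometry (hA : WeaklyRickart A) {k b v : A}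
    (hk : 0 ≤ k) (hv : IsProjection (star v * v)) (hvv : v * v = 0) (hkv : k * (star v * v) = k)
    (hvb : v * b = 0) (hsvb : star v * b = 0) (hb : star b * b ≤ k * k) : ∃ t, b = t * k := by
  have hks := hk.isSelfAdjoint.star_eq
  obtain ⟨c, hc, hcc⟩ : ∃ c : A, star c = c ∧ c * c = k * k - star b * b :=
    ⟨CFC.sqrt (k * k - star b * b), (CFC.sqrt_nonneg _).isSelfAdjoint.star_eq,
      CFC.sqrt_mul_sqrt_self _ (sub_nonneg.2 hb)⟩
  have hcX : c * (star v * v) = c := by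
    refine mul_eq_of_star_mul_self_le (k := k) ?_ hkv
    rw [hc, hcc, hks, sub_le_self_iff]
    exact star_mul_self_nonneg b
  have hbv : star b * v = 0 := by simpa using star_mul_eq_zero hsvb
  have hkb : k * b = 0 := by rw [← hkv, mul_assoc, mul_assoc, hvb, mul_zero, mul_zero]
  have hkv0 : k * v = 0 := by rw [← hkv, mul_assoc, mul_assoc, hvv, mul_zero, mul_zero]
  obtain ⟨s, hs⟩ := hA.exists_mul_eq (y := b + v * c) hks
    (by rw [mul_add, hkb, ← mul_assoc, hkv0, zero_mul, add_zero]) (by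
      have e1 : star b * (v * c) = 0 := by rw [← mul_assoc, hbv, zero_mul]
      have e2 : c * star v * b = 0 := by rw [mul_assoc, hsvb, mul_zero]
      have e3 : c * star v * (v * c) = c * c := by
        rw [mul_assoc, ← mul_assoc (star v), ← mul_assoc c, hcX]
      rw [star_add, star_mul, hc, add_mul, mul_add, mul_add, e1, e2, e3, hcc]
      abel)
  refine ⟨s - v * star v * s, ?_⟩
  have e4 : v * star v * (b + v * c) = v * c := by
    rw [mul_add, mul_assoc, hsvb, mul_zero, zero_add, ← mul_assoc, mul_assoc v,
      hv.mul_star_mul_self]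
  rw [sub_mul, mul_assoc _ s, hs, e4, add_sub_cancel_right]

lemma WeaklyRickart.exists_eq_mul_of_mul_eq_zero (hA : WeaklyRickart A) {k b : A} {g : ℕ → A}
    {c : ℕ → ℝ} (h : IsDiagonalOn k g c) (hkb : k * b = 0) (hb : star b * b ≤ k * k) :
    ∃ t, b = t * k := by
  obtain ⟨R, hR⟩ := hA k
  obtain ⟨v, Z, hv, hZ, hvv, hsum, hvZ, hZv, hvR, hRv, hZR, hgX, hgY, hgZ, hcomm⟩ :=
    hA.exists_matching h hR (star b * b)
  have hks := h.star_eq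
  have hb' : star b * b ≤ star k * k := by rwa [hks]
  have hRb : R * b = 0 := hR.2.2 _ hkb
  have hvb : v * b = 0 := by rw [← hvR, mul_assoc, hRb, mul_zero]
  have hRv' : star v * R = star v := by simpa [hR.1.1] using star_mul_eq hRv
  have hvR' : R * star v = star v := by simpa [hR.1.1] using star_mul_eq hvR
  have hsvb : star v * b = 0 := by rw [← hRv', mul_assoc, hRb, mul_zero]
  have hZb : Z * b = 0 := by rw [← hZR, mul_assoc, hRb, mul_zero]
  have hRZ := hZ.swap_mul_eq_left hR.1 hZR
  have hXk : star v * v * k = k * (star v * v) := h.commute_of_forall_commute hR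
    (by rw [← mul_assoc, hvR']) (by rw [mul_assoc, hvR]) hgX
  have hYk : v * star v * k = k * (v * star v) := h.commute_of_forall_commute hR
    (by rw [← mul_assoc, hRv]) (by rw [mul_assoc, hRv']) hgY
  have hZk : Z * k = k * Z := h.commute_of_forall_commute hR hRZ hZR hgZ
  have hle : ∀ {W : A}, IsDiagonalOn (k * W) (fun n => g n * W) c →
      star (b * W) * (b * W) ≤ k * W * (k * W) := fun {W} hW => by
    simpa only [hW.star_eq] using star_mul_self_mul_le (X := W) hb'
  have dX := h.mul_proj hv hXk hgX
  have dY := h.mul_proj hv.mul_star hYk hgY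
  have dZ := h.mul_proj hZ hZk hgZ
  obtain ⟨t₁, ht₁⟩ := hA.exists_eq_mul_of_partialIsometry (b := b * (star v * v)) dX.nonneg hv hvv
    (by rw [mul_assoc, hv.2]) (by rw [← mul_assoc, hvb, zero_mul])
    (by rw [← mul_assoc, hsvb, zero_mul]) (hle dX)
  obtain ⟨t₂, ht₂⟩ := hA.exists_eq_mul_of_partialIsometry (b := b * (v * star v)) (v := star v)
    dY.nonneg (by rw [star_star]; exact hv.mul_star) (star_mul_eq_zero hvv)
    (by rw [star_star, mul_assoc, hv.mul_star.2]) (by rw [← mul_assoc, hsvb, zero_mul])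
    (by rw [star_star, ← mul_assoc, hvb, zero_mul]) (hle dY)
  obtain ⟨t₃, ht₃⟩ : ∃ t, b * Z = t * (k * Z) := by
    set p := CFC.abs (b * Z) with hp
    have hps : star p = p := (CFC.abs_nonneg (b * Z)).isSelfAdjoint.star_eq
    have hpp : p * p = star (b * Z) * (b * Z) := CFC.abs_mul_abs (b * Z)
    have hpZ : p * Z = p := by
      refine mul_eq_of_star_mul_self_le (k := b * Z) (by rw [hps, hpp]) ?_
      rw [mul_assoc, hZ.2]
    have hZp : Z * p = p := by
      have := star_mul_eq hpZ
      rwa [hZ.1, hps] at this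
    have hpk : Commute p k := by
      have : p = CFC.sqrt (star (b * Z) * (b * Z)) := rfl
      rw [this, star_mul, hZ.1, ← mul_assoc, mul_assoc Z]
      exact Commute.cfcₙ_nnreal hcomm _
    have hpkZ : Commute p (k * Z) := by
      have e : Commute p Z := by rw [commute_iff_eq, hpZ, hZp]
      exact hpk.mul_right e
    have hple : p ≤ k * Z := by
      have := CFC.sqrt_le_sqrt _ _ (hle dZ)
      rwa [CFC.sqrt_mul_self _ dZ.nonneg] at this
    have hp0 : 0 ≤ p := CFC.abs_nonneg _
    obtain ⟨D, hD⟩ := hA.exists_eq_mul_of_le dZ.nonneg hps hpkZ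
      ((neg_nonpos.2 dZ.nonneg).trans hp0) hple
    obtain ⟨s, hs⟩ := hA.exists_mul_eq (k := p) (y := b * Z) hps
      (by rw [← hpZ, mul_assoc, ← mul_assoc Z, hZb, zero_mul, mul_zero]) hpp.symm
    exact ⟨s * D, by rw [mul_assoc, ← hD, hs]⟩
  refine ⟨t₁ * (star v * v) + t₂ * (v * star v) + t₃ * Z, ?_⟩
  have hbR : b * R = b := mul_eq_of_star_mul_self_le hb' hR.2.1
  rw [← hbR, ← hsum, mul_add, mul_add, ht₁, ht₂, ht₃]
  rw [add_mul, add_mul, mul_assoc t₁, hXk, mul_assoc t₂, hYk, mul_assoc t₃, hZk]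

lemma WeaklyRickart.exists_eq_mul_of_le_diagonal (hA : WeaklyRickart A) {k b : A} {g : ℕ → A}
    {c : ℕ → ℝ} (h : IsDiagonalOn k g c) (hb : star b * b ≤ k * k) : ∃ t, b = t * k := by
  obtain ⟨R, hR⟩ := hA k
  obtain ⟨v, Z, hv, hZ, hvv, hsum, hvZ, hZv, hvR, hRv, hZR, hgX, hgY, hgZ, hcomm⟩ :=
    hA.exists_matching h hR b
  have hks := h.star_eq
  have hb' : star b * b ≤ star k * k := by rwa [hks]
  have hRv' : star v * R = star v := by simpa [hR.1.1] using star_mul_eq hRv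
  have hvR' : R * star v = star v := by simpa [hR.1.1] using star_mul_eq hvR
  have hRZ := hZ.swap_mul_eq_left hR.1 hZR
  have hXk : star v * v * k = k * (star v * v) := h.commute_of_forall_commute hR
    (by rw [← mul_assoc, hvR']) (by rw [mul_assoc, hvR]) hgX
  have hYk : v * star v * k = k * (v * star v) := h.commute_of_forall_commute hR
    (by rw [← mul_assoc, hRv]) (by rw [mul_assoc, hRv']) hgY
  have hZk : Z * k = k * Z := h.commute_of_forall_commute hR hRZ hZR hgZ
  have hle : ∀ {W : A}, IsDiagonalOn (k * W) (fun n => g n * W) c →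
      star (b * W) * (b * W) ≤ k * W * (k * W) := fun {W} hW => by
    simpa only [hW.star_eq] using star_mul_self_mul_le (X := W) hb'
  have dX := h.mul_proj hv hXk hgX
  have dY := h.mul_proj hv.mul_star hYk hgY
  have dZ := h.mul_proj hZ hZk hgZ
  have off : ∀ {W : A}, IsProjection W → IsDiagonalOn (k * W) (fun n => g n * W) c →
      ∃ t, b * W - W * (b * W) = t * (k * W) := fun {W} hW dW => by
    refine hA.exists_eq_mul_of_mul_eq_zero dW ?_ (le_trans ?_ (hle dW))
    · rw [mul_assoc, mul_sub, ← mul_assoc W W, hW.2, sub_self, mul_zero]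
    · have e : star (b * W - W * (b * W)) * (b * W - W * (b * W)) =
          star (b * W) * (b * W) - star (W * (b * W)) * (W * (b * W)) := by
        have h1 : star (b * W) * W * (W * (b * W)) = star (b * W) * W * (b * W) := by
          rw [mul_assoc, ← mul_assoc W, hW.2, ← mul_assoc]
        rw [star_sub, star_mul W, hW.1, sub_mul, mul_sub, mul_sub, h1,
          mul_assoc (star (b * W)) W]
        abel
      rw [e, sub_le_self_iff]
      exact star_mul_self_nonneg _
  have diag : ∀ {v : A}, IsProjection (star v * v) → v * v = 0 →
      IsDiagonalOn (k * (star v * v)) (fun n => g n * (star v * v)) c →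
      ∃ t, star v * v * (b * (star v * v)) = t * (k * (star v * v)) := fun {v} hv hvv dX => by
    obtain ⟨t, ht⟩ := hA.exists_eq_mul_of_mul_eq_zero (b := v * (b * (star v * v))) dX
      (by rw [mul_assoc, mul_assoc (star v), ← mul_assoc v v, hvv, zero_mul, mul_zero, mul_zero])
      (le_trans (by
        have := star_mul_self_projection_mul_le (b := b * (star v * v)) hv
        refine le_trans (le_of_eq ?_) this
        calc star (v * (b * (star v * v))) * (v * (b * (star v * v)))
            = star (b * (star v * v)) * (star v * v) * (b * (star v * v)) := by
              rw [star_mul v]; noncomm_ring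
          _ = star (b * (star v * v)) * ((star v * v) * (star v * v)) * (b * (star v * v)) := by
              rw [hv.2]
          _ = _ := by rw [star_mul (star v * v), hv.1]; noncomm_ring) (hle dX))
    exact ⟨star v * t, by rw [mul_assoc, ht, mul_assoc]⟩
  obtain ⟨o₁, ho₁⟩ := off hv dX
  obtain ⟨o₂, ho₂⟩ := off hv.mul_star dY
  obtain ⟨o₃, ho₃⟩ := off hZ dZ
  obtain ⟨d₁, hd₁⟩ := diag hv hvv dX
  obtain ⟨d₂, hd₂⟩ := diag (v := star v) (by rw [star_star]; exact hv.mul_star)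
    (star_mul_eq_zero hvv) (by rw [star_star]; exact dY)
  rw [star_star] at hd₂
  obtain ⟨d₃, hd₃⟩ := hA.exists_eq_mul_of_commute (k := k * Z) (b := Z * (b * Z)) dZ.nonneg (by
      rw [commute_iff_eq, ← mul_assoc Z, ← mul_assoc, hcomm, mul_assoc, mul_assoc (Z * b), hZ.2,
        mul_assoc k, ← mul_assoc Z (Z * b), ← mul_assoc Z Z, hZ.2])
    ((star_mul_self_projection_mul_le hZ).trans (hle dZ))
  refine ⟨(o₁ + d₁) * (star v * v) + (o₂ + d₂) * (v * star v) + (o₃ + d₃) * Z, ?_⟩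
  have hbR : b * R = b := mul_eq_of_star_mul_self_le hb' hR.2.1
  rw [sub_eq_iff_eq_add, hd₁, ← add_mul] at ho₁
  rw [sub_eq_iff_eq_add, hd₂, ← add_mul] at ho₂
  rw [sub_eq_iff_eq_add, hd₃, ← add_mul] at ho₃
  rw [← hbR, ← hsum, mul_add, mul_add, ho₁, ho₂, ho₃, add_mul _ _ k, add_mul _ _ k,
    mul_assoc _ _ k, hXk, mul_assoc _ _ k, hYk, mul_assoc _ Z, hZk]

end Douglas

section Polar

variable {A : Type*} [NonUnitalCStarAlgebra A] [PartialOrder A] [StarOrderedRing A]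

/-- Approximation of the support of a positive element by projections on which it is invertible. -/
lemma WeaklyRickart.exists_spectral_seq (hA : WeaklyRickart A) {h : A} (hh : 0 ≤ h) :
    ∃ E a : ℕ → A, (∀ n, IsProjection (E n)) ∧ (∀ n, star (a n) = a n) ∧
      (∀ n, E n * E (n + 1) = E n) ∧ (∀ n, E n * h = h * E n) ∧ (∀ n, h * a n = a n * h) ∧
      (∀ n m, E n * a m = a m * E n) ∧ (∀ n, E n * (h * a n) = E n) ∧
      ∀ z, (∀ n, E n * z = 0) → h * z = 0 := by
  have hs : IsSelfAdjoint h := hh.isSelfAdjoint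
  have hsp : ∀ t ∈ quasispectrum ℝ h, 0 ≤ t := fun t ht => quasispectrum_nonneg_of_nonneg h hh t ht
  let ε : ℕ → ℝ := fun n => (2⁻¹ : ℝ) ^ n
  have hε : ∀ n, 0 < ε n := fun n => by positivity
  let f : ℕ → ℝ → ℝ := fun n t => max (t - ε n) 0
  let φ : ℕ → ℝ → ℝ := fun n t => t / (max t (ε n)) ^ 2
  have hmax : ∀ n t, 0 < max t (ε n) := fun n t => lt_max_of_lt_right (hε n)
  have hfc : ∀ n, Continuous (f n) := fun n => by fun_prop
  have hφc : ∀ n, Continuous (φ n) := fun n =>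
    continuous_id.div (by fun_prop) fun t => by have := hmax n t; positivity
  have hf0 : ∀ n, f n 0 = 0 := fun n => max_eq_right (by linarith [hε n])
  have hφ0 : ∀ n, φ n 0 = 0 := fun n => zero_div _
  let e : ℕ → A := fun n => cfcₙ (f n) h
  let a : ℕ → A := fun n => cfcₙ (φ n) h
  have hes : ∀ n, star (e n) = e n := fun n => (cfcₙ_predicate (f n) h : IsSelfAdjoint _)
  have has : ∀ n, star (a n) = a n := fun n => (cfcₙ_predicate (φ n) h : IsSelfAdjoint _)
  have heh : ∀ n, e n * h = h * e n := fun n => ((Commute.refl h).cfcₙ_real (f n)).eq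
  have hah : ∀ n, a n * h = h * a n := fun n => ((Commute.refl h).cfcₙ_real (φ n)).eq
  have hea : ∀ n m, e n * a m = a m * e n := fun n m => (cfcₙ_commute_cfcₙ (f n) (φ m) h).eq
  have hprod : ∀ n, e n * (h * a n) = e n := fun n => by
    have h1 : h * a n = cfcₙ (fun t => t * φ n t) h := by
      rw [cfcₙ_mul (fun t => t) (φ n) h continuous_id.continuousOn rfl (hφc n).continuousOn
        (hφ0 n), cfcₙ_id' ℝ h]
    rw [h1, ← cfcₙ_mul (f n) (fun t => t * φ n t) h (hfc n).continuousOn (hf0 n)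
      (continuous_id.mul (hφc n)).continuousOn (by simp [hφ0])]
    refine cfcₙ_congr fun t _ => ?_
    rcases le_total t (ε n) with ht | ht
    · have : f n t = 0 := max_eq_right (by linarith)
      simp [this]
    · have h2 : max t (ε n) = t := max_eq_left ht
      have h3 : t ≠ 0 := by linarith [hε n]
      simp only [φ, h2]
      field_simp
  have hmono : ∀ n, star (e n) * e n ≤ star (e (n + 1)) * e (n + 1) := fun n => by
    rw [hes, hes, ← cfcₙ_mul _ _ h (hfc n).continuousOn (hf0 n) (hfc n).continuousOn (hf0 n),
      ← cfcₙ_mul _ _ h (hfc _).continuousOn (hf0 _) (hfc _).continuousOn (hf0 _)]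
    refine cfcₙ_mono (fun t _ => ?_) ((hfc _).mul (hfc _)).continuousOn
      ((hfc _).mul (hfc _)).continuousOn
    have h1 : ε (n + 1) ≤ ε n := pow_le_pow_of_le_one (by norm_num) (by norm_num) (Nat.le_succ n)
    have h2 : f n t ≤ f (n + 1) t := max_le_max (by linarith) le_rfl
    have h3 : 0 ≤ f n t := le_max_right _ _
    exact mul_le_mul h2 h2 h3 (h3.trans h2)
  have hnorm : ∀ n, ‖h - e n‖ ≤ ε n := fun n => by
    have h1 : h - e n = cfcₙ (fun t => t - f n t) h := by
      rw [cfcₙ_sub (fun t => t) (f n) h continuous_id.continuousOn rfl (hfc n).continuousOn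
        (hf0 n), cfcₙ_id' ℝ h]
    rw [h1]
    refine norm_cfcₙ_le fun t ht => ?_
    have h0 := hsp t ht
    rw [Real.norm_eq_abs, abs_le]
    rcases le_total t (ε n) with ht | ht
    · have : f n t = 0 := max_eq_right (by linarith)
      rw [this]
      constructor <;> linarith [hε n]
    · have : f n t = t - ε n := max_eq_left (by linarith)
      rw [this]
      constructor <;> linarith [hε n]
  choose E hE using fun n => hA (e n)
  refine ⟨E, a, fun n => (hE n).1, has, fun n => ?_, fun n => ?_, fun n => (hah n).symm,
    fun n m => ?_, fun n => ?_, fun z hz => ?_⟩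
  · exact (hE n).mul_eq_of_mul_eq (mul_eq_of_star_mul_self_le (hmono n) (hE (n + 1)).2.1)
  · exact ((hE n).commute hs.star_eq (heh n)).symm
  · exact ((hE n).commute (has m) (hea n m)).symm
  · exact (hE n).mul_eq_of_mul_eq (hprod n)
  · have h1 : ∀ n, ‖h * z‖ ≤ ε n * ‖z‖ := fun n => by
      have : h * z = (h - e n) * z := by
        rw [sub_mul, (hE n).mul_eq_zero_iff.2 (hz n), sub_zero]
      rw [this]
      exact (norm_mul_le _ _).trans (mul_le_mul_of_nonneg_right (hnorm n) (norm_nonneg _))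
    have h2 : Filter.Tendsto (fun n => ε n * ‖z‖) Filter.atTop (nhds 0) := by
      have := (tendsto_pow_atTop_nhds_zero_of_lt_one (r := (2⁻¹ : ℝ)) (by norm_num)
        (by norm_num)).mul_const ‖z‖
      rwa [zero_mul] at this
    exact norm_le_zero_iff.1 (ge_of_tendsto' h2 h1)

lemma WeaklyRickart.exists_polar (hA : WeaklyRickart A) (x : A) :
    ∃ e, IsProjection (star e * e) ∧ x * (star e * e) = x ∧ e * star e * x = x ∧
      (∀ z, x * z = 0 → e * z = 0) ∧ ∀ z, z * x = 0 → z * e = 0 := by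
  have hhs : star (CFC.abs x) = CFC.abs x := (CFC.abs_nonneg x).isSelfAdjoint.star_eq
  have hhh : CFC.abs x * CFC.abs x = star x * x := CFC.abs_mul_abs x
  obtain ⟨E, a, hE, has, hEE, hEh, hha, hEa, hEha, hfaith⟩ :=
    hA.exists_spectral_seq (CFC.abs_nonneg x)
  set h := CFC.abs x
  obtain ⟨F, hF0, hFs⟩ : ∃ F : ℕ → A, F 0 = 0 ∧ ∀ n, F (n + 1) = E n :=
    ⟨fun n => Nat.casesOn n 0 E, rfl, fun _ => rfl⟩
  have hF : ∀ n, IsProjection (F n) := fun n => by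
    cases n with
    | zero => exact hF0 ▸ IsProjection.zero
    | succ n => exact hFs n ▸ hE n
  have hF1 : ∀ n, F n * F (n + 1) = F n := fun n => by
    cases n with
    | zero => rw [hF0, zero_mul]
    | succ n => rw [hFs, hFs, hEE]
  have hFF : ∀ i j, i ≤ j → F i * F j = F i := fun i j hij => by
    induction j, hij using Nat.le_induction with
    | base => exact (hF i).2
    | succ j hij ih => rw [← ih, mul_assoc, hF1]
  have hFF' : ∀ i j, i ≤ j → F j * F i = F i := fun i j hij =>
    (hF i).swap_mul_eq_left (hF j) (hFF i j hij)
  have hFh : ∀ n, F n * h = h * F n := fun n => by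
    cases n with
    | zero => rw [hF0, zero_mul, mul_zero]
    | succ n => rw [hFs, hEh]
  have hFa : ∀ n m, F n * a m = a m * F n := fun n m => by
    cases n with
    | zero => rw [hF0, zero_mul, mul_zero]
    | succ n => rw [hFs, hEa]
  let g : ℕ → A := fun n => F (n + 1) - F n
  have hg : ∀ n, IsProjection (g n) := fun n => (hF (n + 1)).sub (hF n) (hF1 n)
  have hgE : ∀ n, g n * E n = g n := fun n => by
    rw [← hFs, sub_mul, (hF _).2, hF1]
  have hgg : ∀ i j, i < j → g i * g j = 0 := fun i j hij => by
    simp only [g, sub_mul, mul_sub]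
    rw [hFF _ _ (by omega), hFF _ _ (by omega), hFF _ _ (by omega), hFF _ _ (by omega)]
    abel
  have hgg' : ∀ i j, i ≠ j → g i * g j = 0 := fun i j hij => by
    rcases lt_or_gt_of_ne hij with hij | hij
    · exact hgg i j hij
    · exact (hg j).swap_mul_eq_zero (hg i) (hgg j i hij)
  have hgh : ∀ n, g n * h = h * g n := fun n => by simp only [g, sub_mul, mul_sub, hFh]
  have hga : ∀ n m, g n * a m = a m * g n := fun n m => by simp only [g, sub_mul, mul_sub, hFa]
  have hgha : ∀ n, g n * (h * a n) = g n := fun n => by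
    rw [← hgE, mul_assoc, hEha]
  have hgx : ∀ z, (∀ n, g n * z = 0) → x * z = 0 := fun z hz => by
    refine mul_eq_zero_of_star_mul_self (x := h) (by rw [hhs, hhh]) (hfaith z ?_)
    have : ∀ n, F n * z = 0 := fun n => by
      induction n with
      | zero => rw [hF0, zero_mul]
      | succ n ih =>
        have := hz n
        rwa [sub_mul, ih, sub_zero] at this
    exact fun n => hFs n ▸ this (n + 1)
  have hgc : ∀ n m, g n * (h * a m) = h * a m * g n := fun n m => by
    rw [← mul_assoc, hgh, mul_assoc, hga, mul_assoc]
  let u : ℕ → A := fun n => x * a n * g n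
  have hu : ∀ n m, star (u n) * u m = g n * (h * a n) * (g n * g m) * (h * a m) := fun n m => by
    calc star (u n) * u m = g n * a n * (star x * x) * a m * g m := by
          simp only [u, star_mul, has, (hg n).1]; noncomm_ring
      _ = g n * (a n * h) * (h * (a m * g m)) := by rw [← hhh]; noncomm_ring
      _ = g n * (g n * (h * a n)) * (h * (a m * g m)) := by rw [← hha, ← mul_assoc (g n) (g n),
          (hg n).2]
      _ = g n * (h * a n) * (g n * g m) * (h * a m) := by
          have h1 : g n * (g n * (h * a n)) = g n * (h * a n) * g n := by rw [mul_assoc, ← hgc]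
          rw [← hga, ← mul_assoc h, ← hgh, mul_assoc (g m), h1]
          simp only [mul_assoc]
  have hun : ∀ n, star (u n) * u n = g n := fun n => by
    rw [hu, (hg n).2, hgha, (hg n).2, hgha]
  have hum : ∀ n m, n ≠ m → star (u n) * u m = 0 := fun n m hnm => by
    rw [hu, hgg' n m hnm, mul_zero, zero_mul]
  obtain ⟨k, b, hk, hbk, hbu, hd⟩ := exists_isDiagonalOn_of_orthogonal hg hgg' hun hum
  obtain ⟨t, ht⟩ := hA.exists_eq_mul_of_le_diagonal hk hbk.le
  obtain ⟨R, hR⟩ := hA k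
  have hks := hk.star_eq
  have hRk := hR.self_mul hks
  have heR : star (t * R) * (t * R) = R := by
    have h1 : k * (star t * t * k) = k * k := by
      rw [← hbk, ht, star_mul, hks]; noncomm_ring
    have h2 : R * (star t * t) * R = R * R := by
      refine hR.mul_right_eq hks ?_
      rw [mul_assoc]
      exact hR.mul_eq_mul_iff.1 h1
    calc star (t * R) * (t * R) = R * (star t * t) * R := by
          rw [star_mul, hR.1.1]; noncomm_ring
      _ = R := by rw [h2, hR.1.2]
  have hek : t * R * k = b := by rw [mul_assoc, hRk, ht]
  have hkg : ∀ z, k * z = 0 → ∀ n, g n * z = 0 := fun z hz n => by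
    have h1 : (2⁻¹ : ℝ) ^ n • (g n * z) = 0 := by
      rw [← smul_mul_assoc, ← hk.left, mul_assoc, hz, mul_zero]
    exact (smul_eq_zero.1 h1).resolve_left (by positivity)
  have hxR : x * R = x := sub_mul_eq_zero_of_forall fun z => by
    have := hgx (R * z - z) (hkg _ (by rw [mul_sub, ← mul_assoc, hR.2.1, sub_self]))
    rwa [mul_sub, sub_eq_zero, ← mul_assoc] at this
  have hxg : ∀ n, x * g n = u n * h := fun n => by
    calc x * g n = x * (h * a n * g n) := by rw [← hgc, hgha]
      _ = u n * h := by simp only [u, mul_assoc, hgh]; rw [← mul_assoc h, hha, mul_assoc]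
  set e := t * R with he
  have hee : e * star e * b = b := by
    rw [← hek, mul_assoc, ← mul_assoc (star e), heR, hRk]
  have hbu' : ∀ n, e * star e * u n = u n := fun n => by
    have h1 : (2⁻¹ : ℝ) ^ n • (e * star e * u n) = (2⁻¹ : ℝ) ^ n • u n := by
      rw [← mul_smul_comm, ← hbu, ← mul_assoc, hee]
    exact smul_right_injective A (pow_ne_zero n (by norm_num : (2⁻¹ : ℝ) ≠ 0)) h1
  refine ⟨e, heR ▸ hR.1, by rw [heR, hxR], ?_, fun z hz => ?_, fun z hz => ?_⟩
  · have h1 : x * star (e * star e * x - x) = 0 := hgx _ fun n => by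
      have h2 : (e * star e * x - x) * g n = 0 := by
        rw [sub_mul, mul_assoc, hxg, ← mul_assoc, hbu', sub_self]
      simpa only [(hg n).1] using star_mul_eq_zero h2
    have h3 := star_mul_eq_zero h1
    rw [star_star] at h3
    rw [← sub_eq_zero, ← CStarRing.mul_star_self_eq_zero_iff]
    calc _ = (e * star e * x - x) * star x * (e * star e) - (e * star e * x - x) * star x := by
          simp only [star_sub, star_mul, star_star]; noncomm_ring
      _ = 0 := by rw [h3, zero_mul, sub_zero]
  · have h1 : h * z = 0 := mul_eq_zero_of_star_mul_self (x := x) (by rw [hhs, hhh]) hz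
    have h2 : k * z = 0 := hk.faithful z fun n => by
      rw [← hgha, hha, mul_assoc, mul_assoc, h1, mul_zero, mul_zero]
    rw [he, mul_assoc, hR.2.2 z h2, mul_zero]
  · have h1 : z * b = 0 := hd z fun j => by
      simp only [u]
      rw [← mul_assoc, ← mul_assoc, hz, zero_mul, zero_mul]
    rw [← hek, ← mul_assoc] at h1
    have := hR.mul_right_eq_zero hks h1
    rwa [he, mul_assoc, mul_assoc, hR.1.2] at this

end Polar

section Peirce

variable {A : Type*} [NonUnitalCStarAlgebra A]

lemma isClosed_peirce2 (e : A) : IsClosed (Peirce2 e) :=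
  isClosed_eq (by fun_prop) (by fun_prop)

lemma mul_mul_mem_innerIdealGen (x a : A) : x * a * x ∈ innerIdealGen x :=
  subset_closure ⟨a, rfl⟩

/-- The elements orthogonal to a self-adjoint element. -/
def orthogonalInnerIdeal (h : A) : Submodule ℂ A where
  carrier := {y | h * y = 0 ∧ y * h = 0}
  zero_mem' := ⟨mul_zero _, zero_mul _⟩
  add_mem' := fun ha hb => ⟨by rw [mul_add, ha.1, hb.1, add_zero],
    by rw [add_mul, ha.2, hb.2, add_zero]⟩
  smul_mem' := fun c y hy => ⟨by rw [mul_smul_comm, hy.1, smul_zero],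
    by rw [smul_mul_assoc, hy.2, smul_zero]⟩

lemma isInnerIdeal_orthogonalInnerIdeal (h : A) : IsInnerIdeal (orthogonalInnerIdeal h) :=
  fun x hx y hy a => ⟨by rw [← mul_assoc, ← mul_assoc, hx.1, zero_mul, zero_mul],
    by rw [mul_assoc, hy.2, mul_zero]⟩

lemma orthog_of_mem_innerIdealGen {h s t : A} (hh : star h = h) (hs : s ∈ innerIdealGen h)
    (ht : t ∈ orthogonalInnerIdeal h) : Orthog s t := by
  have h1 : h * star t = 0 := by rw [← hh, ← star_mul, ht.2, star_zero]
  have h2 : star t * h = 0 := by rw [← hh, ← star_mul, ht.1, star_zero]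
  have hc : IsClosed {s : A | Orthog s t} :=
    (isClosed_eq (by fun_prop) continuous_const).inter
      (isClosed_eq (by fun_prop) continuous_const)
  refine closure_minimal ?_ hc hs
  rintro _ ⟨a, rfl⟩
  exact ⟨by rw [mul_assoc, h1, mul_zero],
    by rw [← mul_assoc, ← mul_assoc, h2, zero_mul, zero_mul]⟩

lemma weaklyRickart_of_peirce_condition
    (H : ∀ (x : A) (J : Submodule ℂ A), IsInnerIdeal J →
      (∀ s ∈ innerIdealGen x, ∀ t ∈ (J : Set A), Orthog s t) →
      ∃ e : A, IsPartialIsometry e ∧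
        innerIdealGen x ⊆ Peirce2 e ∧ (J : Set A) ⊆ Peirce0 e) : WeaklyRickart A := by
  intro x
  have hh : star (star x * x) = star x * x := by rw [star_mul, star_star]
  obtain ⟨e, he, h2, h0⟩ := H (star x * x) (orthogonalInnerIdeal (star x * x))
    (isInnerIdeal_orthogonalInnerIdeal _) fun s hs t ht => orthog_of_mem_innerIdealGen hh hs ht
  set h := star x * x with hdef
  set p := e * star e with hp
  have h3 : p * (h * h * h) = h * h * h := by
    have := h2 (mul_mul_mem_innerIdealGen h h)
    rw [Peirce2, Set.mem_ofPred_eq] at this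
    rw [← this, ← mul_assoc p, ← mul_assoc p, ← hp, he.2]
  have hps : star p = p := he.1
  have h4 : h * (h * (h * p)) = h * (h * h) := by
    have := congrArg star h3
    simpa only [star_mul, hh, hps, mul_assoc] using this
  have h5 : x * p = x := by
    refine sub_mul_eq_zero_of_forall fun z => ?_
    have h6 : h * (h * (h * (p * z - z))) = 0 := by
      rw [mul_sub, mul_sub, mul_sub, sub_eq_zero]
      simpa only [mul_assoc] using congrArg (· * z) h4
    have cancel : ∀ w, h * (h * w) = 0 → h * w = 0 := fun w hw =>
      mul_eq_zero_of_star_mul_mul (by rwa [hh])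
    have h7 := cancel _ (cancel _ h6)
    rw [hdef, mul_assoc] at h7
    have h8 := mul_eq_zero_of_star_mul_mul h7
    rwa [mul_sub, sub_eq_zero, ← mul_assoc] at h8
  refine ⟨p, he, h5, fun y hy => ?_⟩
  have hyJ : y * star y ∈ orthogonalInnerIdeal h := by
    have h1 : h * y = 0 := by rw [hdef, mul_assoc, hy, mul_zero]
    refine ⟨by rw [← mul_assoc, h1, zero_mul], ?_⟩
    rw [mul_assoc, ← hh, ← star_mul, h1, star_zero, mul_zero]
  rw [← CStarRing.mul_star_self_eq_zero_iff, star_mul, he.1, mul_assoc, ← mul_assoc y,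
    ← mul_assoc, (h0 hyJ).1, zero_mul]

lemma WeaklyRickart.peirce_condition (hA : WeaklyRickart A) (x : A) (J : Set A)
    (hJ : ∀ s ∈ innerIdealGen x, ∀ t ∈ J, Orthog s t) :
    ∃ e : A, IsPartialIsometry e ∧ innerIdealGen x ⊆ Peirce2 e ∧ J ⊆ Peirce0 e := by
  let _ := CStarAlgebra.spectralOrder A
  have := CStarAlgebra.spectralOrderedRing A
  obtain ⟨e, he, hxe, hex, hr, hl⟩ := hA.exists_polar x
  refine ⟨e, he.mul_star, closure_minimal ?_ (isClosed_peirce2 e), fun z hz => ?_⟩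
  · rintro _ ⟨a, rfl⟩
    change e * star e * (x * a * x) * (star e * e) = x * a * x
    rw [mul_assoc (e * star e), mul_assoc (x * a), hxe, ← mul_assoc, ← mul_assoc, hex]
  · obtain ⟨h1, h2⟩ := hJ _ (mul_mul_mem_innerIdealGen x (star x)) z hz
    have h3 : x * star z = 0 := by
      refine mul_eq_zero_of_star_mul_mul (mul_eq_zero_of_star_mul_mul (x := star x) ?_)
      rw [star_star, ← mul_assoc, ← mul_assoc, h1]
    have h4 : star z * x = 0 := by
      have h5 := star_mul_eq_zero h2
      simp only [star_mul, star_star, mul_assoc] at h5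
      have h6 := mul_eq_zero_of_star_mul_mul (x := star x)
        (by rw [star_star]; exact mul_eq_zero_of_star_mul_mul h5)
      simpa using star_mul_eq_zero h6
    have h5 := star_mul_eq_zero (hr _ h3)
    have h6 := star_mul_eq_zero (hl _ h4)
    rw [star_star] at h5 h6
    exact ⟨by rw [mul_assoc, h6, mul_zero], by rw [← mul_assoc, h5, zero_mul]⟩

end Peirce

/-- A C*-algebra `A` is weakly Rickart if, and only if, for every `x ∈ A` and every inner
ideal `J ⊆ A` orthogonal to the inner ideal `A(x)` generated by `x`, there exists a
partial isometry `e ∈ A` with `A(x) ⊆ A₂(e)` and `J ⊆ A₀(e)`. -/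
theorem weaklyRickart_iff_peirce_condition {A : Type*} [NonUnitalCStarAlgebra A] :
    WeaklyRickart A ↔
      ∀ (x : A) (J : Submodule ℂ A), IsInnerIdeal J →
        (∀ s ∈ innerIdealGen x, ∀ t ∈ (J : Set A), Orthog s t) →
        ∃ e : A, IsPartialIsometry e ∧
          innerIdealGen x ⊆ Peirce2 e ∧ (J : Set A) ⊆ Peirce0 e := by
  exact ⟨fun hA x J _ hJ => hA.peirce_condition x J hJ, weaklyRickart_of_peirce_condition⟩
end
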